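/- arXiv:math/0311124 — 4 statements merged into one kernel-verified Lean document; each statement's English description precedes it below -/
import Mathlib

section
/- The monomial ideal J = (z², yz, xz, zb², za², ytb², xtb², xta²) in k[x,y,z,t,a,b,c] does not have the saturated chain property: the associated prime Q = (x,y,z,a,b) of R/J is non-minimal, but there is no associated prime P of R/J with P ⊂ Q and dim(R/P) = dim(R/Q) + 1. -/
open MvPolynomial

namespace SatChain

section
variable {k : Type*} [Field k]

theorem ker_killCompl_eq (s : Set (Fin 7)) :
    RingHom.ker (killCompl (R := k) (Subtype.val_injective (p := fun i => i ∈ sᶜ))) =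
      Ideal.span (X '' s) := by
  ext p
  constructor
  · intro hp
    rw [mem_ideal_span_X_image]
    intro m hm
    by_contra! h
    have hsub : (↑m.support : Set (Fin 7)) ⊆ Set.range (Subtype.val : {i // i ∈ sᶜ} → Fin 7) := by
      intro i hi
      refine ⟨⟨i, fun his => ?_⟩, rfl⟩
      exact (Finsupp.mem_support_iff.mp hi) (h i his)
    have h1 := m.mapDomain_comapDomain (Subtype.val : {i // i ∈ sᶜ} → Fin 7)
      Subtype.val_injective hsub
    have h2 := coeff_killCompl (R := k) (p := p) (Subtype.val_injective (p := fun i => i ∈ sᶜ))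
      (s := m.comapDomain _ Subtype.val_injective.injOn)
    rw [h1, (RingHom.mem_ker).mp hp, coeff_zero] at h2
    exact (mem_support_iff.mp hm) h2.symm
  · intro hp
    have : Ideal.span (X '' s) ≤
        RingHom.ker (killCompl (R := k) (Subtype.val_injective (p := fun i => i ∈ sᶜ))) := by
      rw [Ideal.span_le]
      rintro _ ⟨i, hi, rfl⟩
      simp only [SetLike.mem_coe, RingHom.mem_ker]
      rw [killCompl, aeval_X, dif_neg]
      rintro ⟨⟨j, hj⟩, rfl⟩
      exact hj hi
    exact this hp

theorem killCompl_surj (s : Set (Fin 7)) : Function.Surjective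
    (killCompl (R := k) (Subtype.val_injective (p := fun i => i ∈ sᶜ))) := fun p =>
  ⟨rename Subtype.val p, killCompl_rename_app _ p⟩

theorem prime_X (s : Set (Fin 7)) :
    (Ideal.span (X '' s : Set (MvPolynomial (Fin 7) k))).IsPrime := by
  rw [← ker_killCompl_eq]
  exact RingHom.ker_isPrime _

theorem dim_X (s : Set (Fin 7)) :
    ringKrullDim (MvPolynomial (Fin 7) k ⧸ Ideal.span (X '' s : Set (MvPolynomial (Fin 7) k)))
      = Nat.card {i // i ∈ sᶜ} := by
  rw [← ker_killCompl_eq]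
  refine (ringKrullDim_eq_of_ringEquiv (RingHom.quotientKerEquivOfSurjective
    (f := (killCompl (R := k) (Subtype.val_injective (p := fun i => i ∈ sᶜ))).toRingHom)
    (killCompl_surj s))).trans ?_
  rw [MvPolynomial.ringKrullDim_of_isNoetherianRing]
  simp

theorem mem_col {R : Type*} [CommRing R] (I : Ideal R) (r f : R) :
    r ∈ (⊥ : Submodule R (R ⧸ I)).colon {Ideal.Quotient.mk I f} ↔ r * f ∈ I := by
  rw [Submodule.mem_colon_singleton, Submodule.mem_bot]
  exact Ideal.Quotient.eq_zero_iff_mem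

theorem step {R : Type*} [CommRing R] (q q' p : Ideal R) (s : R)
    (hle : q ≤ q') (hq' : q' ≤ q ⊔ Ideal.span {s}) (hs : ∀ h ∈ q', s * h ∈ q)
    (hc : ∀ h, s * h ∈ q → h ∈ q') (C : ∀ g f, g * f ∈ q' → g ∈ p ∨ f ∈ q') :
    ∀ g f, g * f ∈ q → g ∈ p ∨ f ∈ q := by
  intro g f hgf
  rcases C g f (hle hgf) with h | h
  · exact Or.inl h
  by_cases hg : g ∈ p
  · exact Or.inl hg
  right
  obtain ⟨u, hu, v, hv, rfl⟩ := Submodule.mem_sup.mp (hq' h)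
  obtain ⟨w, rfl⟩ := Ideal.mem_span_singleton'.mp hv
  have h1 : s * (g * w) ∈ q := by
    have : s * (g * w) = g * (u + w * s) - g * u := by ring
    rw [this]
    exact q.sub_mem hgf (q.mul_mem_left _ hu)
  have h2 := (C g w (hc _ h1)).resolve_left hg
  refine q.add_mem hu ?_
  rw [mul_comm]
  exact hs _ h2

theorem mem_J (f : MvPolynomial (Fin 7) k) :
    f ∈ Ideal.span {(X 2 : MvPolynomial (Fin 7) k) ^ 2, X 1 * X 2, X 0 * X 2,
          X 2 * X 5 ^ 2, X 2 * X 4 ^ 2, X 1 * X 3 * X 5 ^ 2, X 0 * X 3 * X 5 ^ 2,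
          X 0 * X 3 * X 4 ^ 2} ↔ ∀ m ∈ f.support, 2 ≤ m 2 ∨ (1 ≤ m 1 ∧ 1 ≤ m 2) ∨
          (1 ≤ m 0 ∧ 1 ≤ m 2) ∨ (1 ≤ m 2 ∧ 2 ≤ m 5) ∨ (1 ≤ m 2 ∧ 2 ≤ m 4) ∨
          (1 ≤ m 1 ∧ 1 ≤ m 3 ∧ 2 ≤ m 5) ∨ (1 ≤ m 0 ∧ 1 ≤ m 3 ∧ 2 ≤ m 5) ∨
          (1 ≤ m 0 ∧ 1 ≤ m 3 ∧ 2 ≤ m 4) := by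
  have := @mem_ideal_span_monomial_image (Fin 7) k _ f {Finsupp.single 2 2,
    Finsupp.single 1 1 + Finsupp.single 2 1, Finsupp.single 0 1 + Finsupp.single 2 1,
    Finsupp.single 2 1 + Finsupp.single 5 2, Finsupp.single 2 1 + Finsupp.single 4 2,
    Finsupp.single 1 1 + Finsupp.single 3 1 + Finsupp.single 5 2,
    Finsupp.single 0 1 + Finsupp.single 3 1 + Finsupp.single 5 2,
    Finsupp.single 0 1 + Finsupp.single 3 1 + Finsupp.single 4 2}
  simp only [Set.image_insert_eq, Set.image_singleton] at this
  simp only [X, monomial_pow, monomial_mul, one_pow, one_mul, Finsupp.smul_single, smul_eq_mul,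
    mul_one]
  rw [this]
  refine forall₂_congr fun m _ => ?_
  simp [Finsupp.le_def, Fin.forall_fin_succ, Finsupp.single_apply, Fin.ext_iff]
  try rfl

theorem mem_q3 (f : MvPolynomial (Fin 7) k) :
    f ∈ Ideal.span {(X 0 : MvPolynomial (Fin 7) k), X 2, X 5 ^ 2} ↔
      ∀ m ∈ f.support, 1 ≤ m 0 ∨ 1 ≤ m 2 ∨ 2 ≤ m 5 := by
  have := @mem_ideal_span_monomial_image (Fin 7) k _ f {Finsupp.single 0 1,
    Finsupp.single 2 1, Finsupp.single 5 2}
  simp only [Set.image_insert_eq, Set.image_singleton] at this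
  simp only [X, monomial_pow, one_pow, Finsupp.smul_single, smul_eq_mul, mul_one]
  rw [this]
  refine forall₂_congr fun m _ => ?_
  simp [Finsupp.le_def, Fin.forall_fin_succ, Finsupp.single_apply, Fin.ext_iff]
  try rfl

theorem mem_q4aux (f : MvPolynomial (Fin 7) k) :
    f ∈ Ideal.span {(X 2 : MvPolynomial (Fin 7) k), X 4, X 5 ^ 2} ↔
      ∀ m ∈ f.support, 1 ≤ m 2 ∨ 1 ≤ m 4 ∨ 2 ≤ m 5 := by
  have := @mem_ideal_span_monomial_image (Fin 7) k _ f {Finsupp.single 2 1,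
    Finsupp.single 4 1, Finsupp.single 5 2}
  simp only [Set.image_insert_eq, Set.image_singleton] at this
  simp only [X, monomial_pow, one_pow, Finsupp.smul_single, smul_eq_mul, mul_one]
  rw [this]
  refine forall₂_congr fun m _ => ?_
  simp [Finsupp.le_def, Fin.forall_fin_succ, Finsupp.single_apply, Fin.ext_iff]
  try rfl

theorem mem_q4 (f : MvPolynomial (Fin 7) k) :
    f ∈ Ideal.span {(X 2 : MvPolynomial (Fin 7) k), X 4 ^ 2, X 5 ^ 2} ↔
      ∀ m ∈ f.support, 1 ≤ m 2 ∨ 2 ≤ m 4 ∨ 2 ≤ m 5 := by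
  have := @mem_ideal_span_monomial_image (Fin 7) k _ f {Finsupp.single 2 1,
    Finsupp.single 4 2, Finsupp.single 5 2}
  simp only [Set.image_insert_eq, Set.image_singleton] at this
  simp only [X, monomial_pow, one_pow, Finsupp.smul_single, smul_eq_mul, mul_one]
  rw [this]
  refine forall₂_congr fun m _ => ?_
  simp [Finsupp.le_def, Fin.forall_fin_succ, Finsupp.single_apply, Fin.ext_iff]
  try rfl

theorem mem_q5 (f : MvPolynomial (Fin 7) k) :
    f ∈ Ideal.span {(X 0 : MvPolynomial (Fin 7) k), X 1, X 2 ^ 2, X 4 ^ 2, X 5 ^ 2} ↔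
      ∀ m ∈ f.support, 1 ≤ m 0 ∨ 1 ≤ m 1 ∨ 2 ≤ m 2 ∨ 2 ≤ m 4 ∨ 2 ≤ m 5 := by
  have := @mem_ideal_span_monomial_image (Fin 7) k _ f {Finsupp.single 0 1, Finsupp.single 1 1,
    Finsupp.single 2 2, Finsupp.single 4 2, Finsupp.single 5 2}
  simp only [Set.image_insert_eq, Set.image_singleton] at this
  simp only [X, monomial_pow, one_pow, Finsupp.smul_single, smul_eq_mul, mul_one]
  rw [this]
  refine forall₂_congr fun m _ => ?_
  simp [Finsupp.le_def, Fin.forall_fin_succ, Finsupp.single_apply, Fin.ext_iff]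
  try rfl

theorem mem_X (s : Set (Fin 7)) (f : MvPolynomial (Fin 7) k) :
    f ∈ Ideal.span (X '' s) ↔ ∀ m ∈ f.support, ∃ i ∈ s, 1 ≤ m i := by
  simp only [mem_ideal_span_X_image, Nat.one_le_iff_ne_zero]

theorem supp_mul (i : Fin 7) (h : MvPolynomial (Fin 7) k) (m : Fin 7 →₀ ℕ) (hm : m ∈ h.support) :
    Finsupp.single i 1 + m ∈ (X i * h).support := by
  rw [mem_support_iff, coeff_X_mul]
  exact mem_support_iff.mp hm

theorem prim3 : ∀ g f : MvPolynomial (Fin 7) k,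
    g * f ∈ Ideal.span {(X 0 : MvPolynomial (Fin 7) k), X 2, X 5 ^ 2} →
    g ∈ Ideal.span (X '' ({0, 2, 5} : Set (Fin 7)) : Set (MvPolynomial (Fin 7) k)) ∨
    f ∈ Ideal.span {(X 0 : MvPolynomial (Fin 7) k), X 2, X 5 ^ 2} := by
  refine step _ (Ideal.span (X '' ({0, 2, 5} : Set (Fin 7)))) _ (X 5) ?_ ?_ ?_ ?_ ?_
  · intro f
    rw [mem_q3, mem_X]
    intro h m hm
    have := h m hm
    simp
    omega
  · simp only [Set.image_insert_eq, Set.image_singleton]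
    rw [← Ideal.span_union]
    apply Ideal.span_mono
    intro x
    simp
    tauto
  · intro h
    have : Ideal.span (X '' ({0, 2, 5} : Set (Fin 7)) : Set (MvPolynomial (Fin 7) k)) ≤
        Submodule.colon (Ideal.span {(X 0 : MvPolynomial (Fin 7) k), X 2, X 5 ^ 2}) {X 5} := by
      rw [Ideal.span_le]
      rintro _ ⟨i, hi, rfl⟩
      simp only [SetLike.mem_coe, Submodule.mem_colon_singleton, smul_eq_mul]
      simp only [Set.mem_insert_iff, Set.mem_singleton_iff] at hi
      rcases hi with rfl | rfl | rfl
      · exact Ideal.mul_mem_right _ _ (Ideal.subset_span (by simp))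
      · exact Ideal.mul_mem_right _ _ (Ideal.subset_span (by simp))
      · rw [← sq]; exact (Ideal.subset_span (by simp))
    intro hh
    have := this hh
    rwa [Submodule.mem_colon_singleton, smul_eq_mul, mul_comm] at this
  · intro h
    rw [mem_q3, mem_X]
    intro hh m hm
    have := hh _ (supp_mul 5 h m hm)
    simp [Finsupp.single_apply] at this ⊢
    omega
  · intro g f h
    exact (prime_X _).mem_or_mem h

theorem prim4aux : ∀ g f : MvPolynomial (Fin 7) k,
    g * f ∈ Ideal.span {(X 2 : MvPolynomial (Fin 7) k), X 4, X 5 ^ 2} →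
    g ∈ Ideal.span (X '' ({2, 4, 5} : Set (Fin 7)) : Set (MvPolynomial (Fin 7) k)) ∨
    f ∈ Ideal.span {(X 2 : MvPolynomial (Fin 7) k), X 4, X 5 ^ 2} := by
  refine step _ (Ideal.span (X '' ({2, 4, 5} : Set (Fin 7)))) _ (X 5) ?_ ?_ ?_ ?_ ?_
  · intro f
    rw [mem_q4aux, mem_X]
    intro h m hm
    have := h m hm
    simp
    omega
  · simp only [Set.image_insert_eq, Set.image_singleton]
    rw [← Ideal.span_union]
    apply Ideal.span_mono
    intro x
    simp
    tauto
  · intro h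
    have : Ideal.span (X '' ({2, 4, 5} : Set (Fin 7)) : Set (MvPolynomial (Fin 7) k)) ≤
        Submodule.colon (Ideal.span {(X 2 : MvPolynomial (Fin 7) k), X 4, X 5 ^ 2}) {X 5} := by
      rw [Ideal.span_le]
      rintro _ ⟨i, hi, rfl⟩
      simp only [SetLike.mem_coe, Submodule.mem_colon_singleton, smul_eq_mul]
      simp only [Set.mem_insert_iff, Set.mem_singleton_iff] at hi
      rcases hi with rfl | rfl | rfl
      · exact Ideal.mul_mem_right _ _ (Ideal.subset_span (by simp))
      · exact Ideal.mul_mem_right _ _ (Ideal.subset_span (by simp))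
      · rw [← sq]; exact (Ideal.subset_span (by simp))
    intro hh
    have := this hh
    rwa [Submodule.mem_colon_singleton, smul_eq_mul, mul_comm] at this
  · intro h
    rw [mem_q4aux, mem_X]
    intro hh m hm
    have := hh _ (supp_mul 5 h m hm)
    simp [Finsupp.single_apply] at this ⊢
    omega
  · intro g f h
    exact (prime_X _).mem_or_mem h

theorem prim4 : ∀ g f : MvPolynomial (Fin 7) k,
    g * f ∈ Ideal.span {(X 2 : MvPolynomial (Fin 7) k), X 4 ^ 2, X 5 ^ 2} →
    g ∈ Ideal.span (X '' ({2, 4, 5} : Set (Fin 7)) : Set (MvPolynomial (Fin 7) k)) ∨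
    f ∈ Ideal.span {(X 2 : MvPolynomial (Fin 7) k), X 4 ^ 2, X 5 ^ 2} := by
  refine step _ (Ideal.span {(X 2 : MvPolynomial (Fin 7) k), X 4, X 5 ^ 2}) _ (X 4) ?_ ?_ ?_ ?_
    prim4aux
  · intro f
    rw [mem_q4aux, mem_q4]
    intro h m hm
    have := h m hm
    omega
  · rw [← Ideal.span_union]
    apply Ideal.span_mono
    intro x
    simp
    tauto
  · intro h
    have : Ideal.span {(X 2 : MvPolynomial (Fin 7) k), X 4, X 5 ^ 2} ≤
        Submodule.colon (Ideal.span {(X 2 : MvPolynomial (Fin 7) k), X 4 ^ 2, X 5 ^ 2}) {X 4} := by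
      rw [Ideal.span_le]
      intro x hx
      simp only [SetLike.mem_coe, Submodule.mem_colon_singleton, smul_eq_mul]
      simp only [Set.mem_insert_iff, Set.mem_singleton_iff] at hx
      rcases hx with rfl | rfl | rfl
      · exact Ideal.mul_mem_right _ _ (Ideal.subset_span (by simp))
      · rw [← sq]; exact (Ideal.subset_span (by simp))
      · exact Ideal.mul_mem_right _ _ (Ideal.subset_span (by simp))
    intro hh
    have := this hh
    rwa [Submodule.mem_colon_singleton, smul_eq_mul, mul_comm] at this
  · intro h
    rw [mem_q4aux, mem_q4]
    intro hh m hm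
    have := hh _ (supp_mul 4 h m hm)
    simp [Finsupp.single_apply] at this ⊢
    omega

theorem Q_eq : Ideal.span {(X 0 : MvPolynomial (Fin 7) k), X 1, X 2, X 4, X 5} =
    Ideal.span (X '' ({0, 1, 2, 4, 5} : Set (Fin 7))) := by
  simp only [Set.image_insert_eq, Set.image_singleton]

theorem X_notMem (s : Set (Fin 7)) (i : Fin 7) (hi : i ∉ s) :
    (X i : MvPolynomial (Fin 7) k) ∉ Ideal.span (X '' s) := by
  rw [mem_X]
  intro h
  obtain ⟨j, hj, h1⟩ := h (Finsupp.single i 1) (by simp [mem_support_iff, X])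
  rw [Finsupp.single_apply] at h1
  split_ifs at h1 with h2
  · exact hi (h2 ▸ hj)
  · omega

theorem decomp (f : MvPolynomial (Fin 7) k) :
    f ∈ Ideal.span {(X 2 : MvPolynomial (Fin 7) k) ^ 2, X 1 * X 2, X 0 * X 2,
          X 2 * X 5 ^ 2, X 2 * X 4 ^ 2, X 1 * X 3 * X 5 ^ 2, X 0 * X 3 * X 5 ^ 2,
          X 0 * X 3 * X 4 ^ 2} ↔
    f ∈ Ideal.span (X '' ({2, 3} : Set (Fin 7)) : Set (MvPolynomial (Fin 7) k)) ∧
    f ∈ Ideal.span (X '' ({0, 1, 2} : Set (Fin 7)) : Set (MvPolynomial (Fin 7) k)) ∧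
    f ∈ Ideal.span {(X 0 : MvPolynomial (Fin 7) k), X 2, X 5 ^ 2} ∧
    f ∈ Ideal.span {(X 2 : MvPolynomial (Fin 7) k), X 4 ^ 2, X 5 ^ 2} ∧
    f ∈ Ideal.span {(X 0 : MvPolynomial (Fin 7) k), X 1, X 2 ^ 2, X 4 ^ 2, X 5 ^ 2} := by
  rw [mem_J, mem_X, mem_X, mem_q3, mem_q4, mem_q5]
  simp only [← forall_and]
  refine forall₂_congr fun m _ => ?_
  simp only [Set.mem_insert_iff, Set.mem_singleton_iff, exists_eq_or_imp, exists_eq_left]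
  omega

end

end SatChain

-- Variables: x = X 0, y = X 1, z = X 2, t = X 3, a = X 4, b = X 5, c = X 6
-- in R = k[x,y,z,t,a,b,c].

/-- The ideal `J = (z², yz, xz, zb², za², ytb², xtb², xta²)` fails the saturated
chain property: `Q = (x,y,z,a,b)` is a non-minimal associated prime of `R/J`, but there is no
associated prime `P ⊆ Q` with `dim(R/P) = dim(R/Q) + 1`. -/
theorem counterexample_no_saturated_chain {k : Type*} [Field k] :
    IsAssociatedPrime (Ideal.span {(X 0 : MvPolynomial (Fin 7) k), X 1, X 2, X 4, X 5})
      (MvPolynomial (Fin 7) k ⧸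
        Ideal.span {(X 2 : MvPolynomial (Fin 7) k) ^ 2, X 1 * X 2, X 0 * X 2,
          X 2 * X 5 ^ 2, X 2 * X 4 ^ 2, X 1 * X 3 * X 5 ^ 2, X 0 * X 3 * X 5 ^ 2,
          X 0 * X 3 * X 4 ^ 2}) ∧
    Ideal.span {(X 0 : MvPolynomial (Fin 7) k), X 1, X 2, X 4, X 5} ∉
      (Ideal.span {(X 2 : MvPolynomial (Fin 7) k) ^ 2, X 1 * X 2, X 0 * X 2,
        X 2 * X 5 ^ 2, X 2 * X 4 ^ 2, X 1 * X 3 * X 5 ^ 2, X 0 * X 3 * X 5 ^ 2,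
        X 0 * X 3 * X 4 ^ 2}).minimalPrimes ∧
    ¬ ∃ P : Ideal (MvPolynomial (Fin 7) k),
        IsAssociatedPrime P
          (MvPolynomial (Fin 7) k ⧸
            Ideal.span {(X 2 : MvPolynomial (Fin 7) k) ^ 2, X 1 * X 2, X 0 * X 2,
              X 2 * X 5 ^ 2, X 2 * X 4 ^ 2, X 1 * X 3 * X 5 ^ 2, X 0 * X 3 * X 5 ^ 2,
              X 0 * X 3 * X 4 ^ 2}) ∧
        P ≤ Ideal.span {(X 0 : MvPolynomial (Fin 7) k), X 1, X 2, X 4, X 5} ∧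
        ringKrullDim (MvPolynomial (Fin 7) k ⧸ P) =
          ringKrullDim (MvPolynomial (Fin 7) k ⧸
            Ideal.span {(X 0 : MvPolynomial (Fin 7) k), X 1, X 2, X 4, X 5}) + 1 := by
  refine ⟨?_, ?_, ?_⟩
  · refine Submodule.isAssociatedPrime_iff.mpr ⟨?_, Ideal.Quotient.mk _ (X 2 * (X 4 * X 5)), ?_⟩
    · rw [SatChain.Q_eq]
      exact SatChain.prime_X _
    · ext r
      rw [SatChain.mem_col]
      constructor
      · intro hr
        have hle : Ideal.span {(X 0 : MvPolynomial (Fin 7) k), X 1, X 2, X 4, X 5} ≤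
            Submodule.colon (Ideal.span {(X 2 : MvPolynomial (Fin 7) k) ^ 2, X 1 * X 2, X 0 * X 2,
              X 2 * X 5 ^ 2, X 2 * X 4 ^ 2, X 1 * X 3 * X 5 ^ 2, X 0 * X 3 * X 5 ^ 2,
              X 0 * X 3 * X 4 ^ 2}) {X 2 * (X 4 * X 5)} := by
          rw [Ideal.span_le]
          intro x hx
          simp only [SetLike.mem_coe, Submodule.mem_colon_singleton, smul_eq_mul]
          simp only [Set.mem_insert_iff, Set.mem_singleton_iff] at hx
          rcases hx with rfl | rfl | rfl | rfl | rfl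
          · rw [← mul_assoc]
            exact Ideal.mul_mem_right _ _ (Ideal.subset_span (by simp))
          · rw [← mul_assoc]
            exact Ideal.mul_mem_right _ _ (Ideal.subset_span (by simp))
          · rw [← mul_assoc, ← sq]
            exact Ideal.mul_mem_right _ _ (Ideal.subset_span (by simp))
          · rw [show (X 4 : MvPolynomial (Fin 7) k) * (X 2 * (X 4 * X 5)) =
              (X 2 * X 4 ^ 2) * X 5 by ring]
            exact Ideal.mul_mem_right _ _ (Ideal.subset_span (by simp))
          · rw [show (X 5 : MvPolynomial (Fin 7) k) * (X 2 * (X 4 * X 5)) =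
              (X 2 * X 5 ^ 2) * X 4 by ring]
            exact Ideal.mul_mem_right _ _ (Ideal.subset_span (by simp))
        exact Submodule.mem_colon_singleton.mp (hle hr)
      · rw [SatChain.mem_J, SatChain.Q_eq, SatChain.mem_X]
        intro h m hm
        have h1 := SatChain.supp_mul 2 _ _ (SatChain.supp_mul 4 _ _ (SatChain.supp_mul 5 r m hm))
        rw [show X 2 * (X 4 * (X 5 * r)) = r * (X 2 * (X 4 * X 5)) by ring] at h1
        have := h _ h1
        simp [Finsupp.single_apply] at this ⊢
        omega
  · intro h
    rw [SatChain.Q_eq] at h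
    have h1 := h.2 (y := Ideal.span (X '' ({0, 1, 2} : Set (Fin 7)))) ⟨SatChain.prime_X _, ?_⟩ ?_
    · exact SatChain.X_notMem {0, 1, 2} 4 (by simp)
        (h1 (Ideal.subset_span ⟨4, by simp, rfl⟩))
    · intro f hf
      exact ((SatChain.decomp f).mp hf).2.1
    · exact Ideal.span_mono (Set.image_mono (by intro i; simp; tauto))
  · rintro ⟨P, hP, hPQ, hdim⟩
    rw [SatChain.Q_eq] at hPQ hdim
    rw [SatChain.dim_X] at hdim
    obtain ⟨hprime, x, hx⟩ := Submodule.isAssociatedPrime_iff.mp hP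
    obtain ⟨f, rfl⟩ := Ideal.Quotient.mk_surjective x
    have key : ∀ r, r ∈ P ↔ r * f ∈ Ideal.span {(X 2 : MvPolynomial (Fin 7) k) ^ 2, X 1 * X 2,
          X 0 * X 2, X 2 * X 5 ^ 2, X 2 * X 4 ^ 2, X 1 * X 3 * X 5 ^ 2, X 0 * X 3 * X 5 ^ 2,
          X 0 * X 3 * X 4 ^ 2} := by
      intro r
      rw [hx, SatChain.mem_col]
    simp only [SatChain.decomp] at key
    have card3 : ∀ s : Finset (Fin 7), s.card = 3 →
        P ≠ Ideal.span (X '' (s : Set (Fin 7))) := by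
      rintro s hs rfl
      rw [SatChain.dim_X] at hdim
      have e1 : Nat.card {i // i ∈ ((s : Set (Fin 7)))ᶜ} = 4 := by
        rw [Nat.card_coe_set_eq, ← Finset.coe_compl, Set.ncard_coe_finset, Finset.card_compl, hs]
        rfl
      have e2 : Nat.card {i // i ∈ (({0, 1, 2, 4, 5} : Set (Fin 7)))ᶜ} = 2 := by
        rw [Nat.card_eq_fintype_card]
        decide
      rw [e1, e2] at hdim
      exact absurd hdim (by exact_mod_cast (by decide : ¬ (4 = 2 + 1)))
    have hmem : ∀ i : Fin 7, ∀ n, (X i : MvPolynomial (Fin 7) k) ^ n ∈ P → X i ∈ P :=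
      fun i n h => hprime.mem_of_pow_mem n h
    have hone : (1 : MvPolynomial (Fin 7) k) ∉ P := (Ideal.ne_top_iff_one _).mp hprime.ne_top
    have hcases : Submodule.colon (Ideal.span (X '' ({2, 3} : Set (Fin 7)))) {f} ≤ P ∨
        Submodule.colon (Ideal.span (X '' ({0, 1, 2} : Set (Fin 7)))) {f} ≤ P ∨
        Submodule.colon (Ideal.span {(X 0 : MvPolynomial (Fin 7) k), X 2, X 5 ^ 2}) {f} ≤ P ∨
        Submodule.colon (Ideal.span {(X 2 : MvPolynomial (Fin 7) k), X 4 ^ 2, X 5 ^ 2}) {f} ≤ P ∨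
        Submodule.colon (Ideal.span
          {(X 0 : MvPolynomial (Fin 7) k), X 1, X 2 ^ 2, X 4 ^ 2, X 5 ^ 2}) {f} ≤ P := by
      rw [← hprime.inf_le, ← hprime.inf_le, ← hprime.inf_le, ← hprime.inf_le]
      intro r hr
      simp only [Submodule.mem_inf, Submodule.mem_colon_singleton, smul_eq_mul] at hr
      exact (key r).mpr hr
    rcases hcases with h | h | h | h | h
    · have : X 3 ∈ P := h (by
        rw [Submodule.mem_colon_singleton]
        exact Ideal.mul_mem_right _ _ (Ideal.subset_span ⟨3, by simp, rfl⟩))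
      exact SatChain.X_notMem _ 3 (by simp) (hPQ this)
    · refine card3 {0, 1, 2} rfl (le_antisymm ?_ ?_)
      · intro r hr
        refine ((SatChain.prime_X _).mem_or_mem
          (I := Ideal.span (X '' (({0, 1, 2} : Finset (Fin 7)) : Set (Fin 7))))
          (by simpa using ((key r).mp hr).2.1)).resolve_right fun hf => hone (h ?_)
        rw [Submodule.mem_colon_singleton]
        simpa using hf
      · rw [Ideal.span_le]
        rintro _ ⟨i, hi, rfl⟩
        apply h
        rw [Submodule.mem_colon_singleton]
        exact Ideal.mul_mem_right _ _ (Ideal.subset_span ⟨i, by simpa using hi, rfl⟩)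
    · refine card3 {0, 2, 5} rfl (le_antisymm ?_ ?_)
      · intro r hr
        have := (SatChain.prim3 r f ((key r).mp hr).2.2.1).resolve_right fun hf => hone (h (by
          rw [Submodule.mem_colon_singleton]; simpa using hf))
        simpa using this
      · rw [Ideal.span_le]
        rintro _ ⟨i, hi, rfl⟩
        simp only [Finset.coe_insert, Finset.coe_singleton, Set.mem_insert_iff,
          Set.mem_singleton_iff] at hi
        rcases hi with rfl | rfl | rfl
        · apply hmem _ 1; apply h; rw [Submodule.mem_colon_singleton]
          exact Ideal.mul_mem_right _ _ (Ideal.subset_span (by simp))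
        · apply hmem _ 1; apply h; rw [Submodule.mem_colon_singleton]
          exact Ideal.mul_mem_right _ _ (Ideal.subset_span (by simp))
        · apply hmem _ 2; apply h; rw [Submodule.mem_colon_singleton]
          exact Ideal.mul_mem_right _ _ (Ideal.subset_span (by simp))
    · refine card3 {2, 4, 5} rfl (le_antisymm ?_ ?_)
      · intro r hr
        have := (SatChain.prim4 r f ((key r).mp hr).2.2.2.1).resolve_right fun hf => hone (h (by
          rw [Submodule.mem_colon_singleton]; simpa using hf))
        simpa using this
      · rw [Ideal.span_le]
        rintro _ ⟨i, hi, rfl⟩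
        simp only [Finset.coe_insert, Finset.coe_singleton, Set.mem_insert_iff,
          Set.mem_singleton_iff] at hi
        rcases hi with rfl | rfl | rfl
        · apply hmem _ 1; apply h; rw [Submodule.mem_colon_singleton]
          exact Ideal.mul_mem_right _ _ (Ideal.subset_span (by simp))
        · apply hmem _ 2; apply h; rw [Submodule.mem_colon_singleton]
          exact Ideal.mul_mem_right _ _ (Ideal.subset_span (by simp))
        · apply hmem _ 2; apply h; rw [Submodule.mem_colon_singleton]
          exact Ideal.mul_mem_right _ _ (Ideal.subset_span (by simp))
    · have hPeq : P = Ideal.span (X '' ({0, 1, 2, 4, 5} : Set (Fin 7))) := by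
        refine le_antisymm hPQ ?_
        rw [Ideal.span_le]
        rintro _ ⟨i, hi, rfl⟩
        simp only [Set.mem_insert_iff, Set.mem_singleton_iff] at hi
        rcases hi with rfl | rfl | rfl | rfl | rfl
        · apply hmem _ 1; apply h; rw [Submodule.mem_colon_singleton]
          exact Ideal.mul_mem_right _ _ (Ideal.subset_span (by simp))
        · apply hmem _ 1; apply h; rw [Submodule.mem_colon_singleton]
          exact Ideal.mul_mem_right _ _ (Ideal.subset_span (by simp))
        · apply hmem _ 2; apply h; rw [Submodule.mem_colon_singleton]
          exact Ideal.mul_mem_right _ _ (Ideal.subset_span (by simp))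
        · apply hmem _ 2; apply h; rw [Submodule.mem_colon_singleton]
          exact Ideal.mul_mem_right _ _ (Ideal.subset_span (by simp))
        · apply hmem _ 2; apply h; rw [Submodule.mem_colon_singleton]
          exact Ideal.mul_mem_right _ _ (Ideal.subset_span (by simp))
      rw [hPeq, SatChain.dim_X] at hdim
      have e2 : Nat.card {i // i ∈ (({0, 1, 2, 4, 5} : Set (Fin 7)))ᶜ} = 2 := by
        rw [Nat.card_eq_fintype_card]
        decide
      rw [e2] at hdim
      exact absurd hdim (by exact_mod_cast (by decide : ¬ (2 = 2 + 1)))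
end

section
/- The ideal P = (xz − a², yz − b², z² − tz − c²) in k[x,y,z,t,a,b,c] is a prime ideal, obtained from the toric ideal (xz − a², yz − b², tz − c²) by the linear change of variables t ↦ z − t. -/
open MvPolynomial

/-- The toric parametrization. -/
noncomputable def toricPhi (k : Type*) [Field k] :
    MvPolynomial (Fin 7) k →ₐ[k] MvPolynomial (Fin 4) k :=
  aeval ![X 0 ^ 2, X 1 ^ 2, X 3 ^ 2, X 2 ^ 2, X 0 * X 3, X 1 * X 3, X 2 * X 3]

theorem toric_monomial_four {k : Type*} [Field k] (p q r s : ℕ) :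
    (X 0 ^ p * X 1 ^ q * X 2 ^ r * X 3 ^ s : MvPolynomial (Fin 4) k) =
      monomial (Finsupp.equivFunOnFinite.symm ![p, q, r, s]) 1 := by
  rw [monomial_eq, Finsupp.prod_fintype _ _ (by simp), Fin.prod_univ_four]
  simp

theorem toric_red {A : Type*} [CommRing A] (x z a : A) (h : a ^ 2 = x * z) (i u : ℕ) :
    x ^ ((2 * i + u) / 2) * a ^ ((2 * i + u) % 2) * z ^ (u / 2) = x ^ i * a ^ u := by
  have h1 : (2 * i + u) / 2 = i + u / 2 := by omega
  have h2 : (2 * i + u) % 2 = u % 2 := by omega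
  rw [h1, h2]
  conv_rhs => rw [← Nat.div_add_mod u 2, pow_add, pow_mul, h, mul_pow]
  ring

theorem toric_isPrime {k : Type*} [Field k] :
    (Ideal.span {(X 0 : MvPolynomial (Fin 7) k) * X 2 - X 4 ^ 2,
          X 1 * X 2 - X 5 ^ 2, X 3 * X 2 - X 6 ^ 2}).IsPrime := by
  set J := Ideal.span {(X 0 : MvPolynomial (Fin 7) k) * X 2 - X 4 ^ 2,
          X 1 * X 2 - X 5 ^ 2, X 3 * X 2 - X 6 ^ 2} with hJ
  let m : Fin 7 → (MvPolynomial (Fin 7) k ⧸ J) := fun i => Ideal.Quotient.mk J (X i)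
  have ha : m 4 ^ 2 = m 0 * m 2 := by
    symm
    simp only [m, ← map_pow, ← map_mul]
    exact Ideal.Quotient.eq.2 (Ideal.subset_span (by simp))
  have hb : m 5 ^ 2 = m 1 * m 2 := by
    symm
    simp only [m, ← map_pow, ← map_mul]
    exact Ideal.Quotient.eq.2 (Ideal.subset_span (by simp))
  have hc : m 6 ^ 2 = m 3 * m 2 := by
    symm
    simp only [m, ← map_pow, ← map_mul]
    exact Ideal.Quotient.eq.2 (Ideal.subset_span (by simp))
  let ψ : MvPolynomial (Fin 4) k →ₗ[k] (MvPolynomial (Fin 7) k ⧸ J) :=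
    (basisMonomials (Fin 4) k).constr k (fun d =>
      m 0 ^ (d 0 / 2) * m 4 ^ (d 0 % 2) * (m 1 ^ (d 1 / 2) * m 5 ^ (d 1 % 2)) *
      (m 3 ^ (d 2 / 2) * m 6 ^ (d 2 % 2)) *
      m 2 ^ ((d 3 - (d 0 % 2 + d 1 % 2 + d 2 % 2)) / 2))
  have hψ : ∀ d : Fin 4 →₀ ℕ, ψ (monomial d 1) =
      m 0 ^ (d 0 / 2) * m 4 ^ (d 0 % 2) * (m 1 ^ (d 1 / 2) * m 5 ^ (d 1 % 2)) *
      (m 3 ^ (d 2 / 2) * m 6 ^ (d 2 % 2)) *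
      m 2 ^ ((d 3 - (d 0 % 2 + d 1 % 2 + d 2 % 2)) / 2) := by
    intro d
    have := (basisMonomials (Fin 4) k).constr_basis k (fun d =>
      m 0 ^ (d 0 / 2) * m 4 ^ (d 0 % 2) * (m 1 ^ (d 1 / 2) * m 5 ^ (d 1 % 2)) *
      (m 3 ^ (d 2 / 2) * m 6 ^ (d 2 % 2)) *
      m 2 ^ ((d 3 - (d 0 % 2 + d 1 % 2 + d 2 % 2)) / 2)) d
    rwa [coe_basisMonomials] at this
  have key : ψ ∘ₗ (toricPhi k).toLinearMap = (Ideal.Quotient.mkₐ k J).toLinearMap := by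
    apply (basisMonomials (Fin 7) k).ext
    intro d
    rw [coe_basisMonomials]
    simp only [LinearMap.comp_apply, AlgHom.toLinearMap_apply]
    have h1 : toricPhi k (monomial d 1) =
        monomial (Finsupp.equivFunOnFinite.symm ![2 * d 0 + d 4, 2 * d 1 + d 5,
          2 * d 3 + d 6, 2 * d 2 + d 4 + d 5 + d 6]) 1 := by
      rw [← toric_monomial_four, toricPhi, aeval_monomial,
        Finsupp.prod_fintype _ _ (by simp), Fin.prod_univ_seven]
      simp
      ring
    have h2 : Ideal.Quotient.mkₐ k J (monomial d 1) =
        (m 0 ^ d 0 * m 4 ^ d 4) * (m 1 ^ d 1 * m 5 ^ d 5) * (m 3 ^ d 3 * m 6 ^ d 6)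
          * m 2 ^ d 2 := by
      rw [monomial_eq, Finsupp.prod_fintype _ _ (by simp), Fin.prod_univ_seven]
      simp [m]
      ring
    rw [h1, h2, hψ, ← toric_red _ _ _ ha (d 0) (d 4),
      ← toric_red _ _ _ hb (d 1) (d 5), ← toric_red _ _ _ hc (d 3) (d 6)]
    have e : ((2 * d 2 + d 4 + d 5 + d 6) - ((2 * d 0 + d 4) % 2 + (2 * d 1 + d 5) % 2
        + (2 * d 3 + d 6) % 2)) / 2 = d 4 / 2 + d 5 / 2 + d 6 / 2 + d 2 := by omega
    simp only [Finsupp.equivFunOnFinite_symm_apply_apply, Matrix.cons_val]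
    rw [e]
    ring
  have hker : J = RingHom.ker (toricPhi k) := by
    apply le_antisymm
    · rw [hJ, Ideal.span_le]
      rintro f (rfl | rfl | rfl) <;> simp [toricPhi] <;> ring
    · intro f hf
      have := LinearMap.congr_fun key f
      simp only [LinearMap.comp_apply, AlgHom.toLinearMap_apply] at this
      rw [RingHom.mem_ker.1 hf, map_zero] at this
      exact Ideal.Quotient.eq_zero_iff_mem.1 this.symm
  rw [hker]
  exact RingHom.ker_isPrime _


open MvPolynomial

-- Variables: x = X 0, y = X 1, z = X 2, t = X 3, a = X 4, b = X 5, c = X 6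
-- in R = k[x,y,z,t,a,b,c].

/-- `P = (xz − a², yz − b², z² − tz − c²)` in `k[x,y,z,t,a,b,c]` is prime, and it
is the image of the toric ideal `(xz − a², yz − b², tz − c²)` under the substitution
`t ↦ z − t`. -/
theorem substituted_toric_ideal_is_prime {k : Type*} [Field k] :
    (Ideal.span {(X 0 : MvPolynomial (Fin 7) k) * X 2 - X 4 ^ 2,
        X 1 * X 2 - X 5 ^ 2, X 2 ^ 2 - X 3 * X 2 - X 6 ^ 2}).IsPrime ∧
    Ideal.map
        (MvPolynomial.aeval (fun i : Fin 7 =>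
          if i = 3 then (X 2 - X 3 : MvPolynomial (Fin 7) k) else X i))
        (Ideal.span {(X 0 : MvPolynomial (Fin 7) k) * X 2 - X 4 ^ 2,
          X 1 * X 2 - X 5 ^ 2, X 3 * X 2 - X 6 ^ 2}) =
      Ideal.span {(X 0 : MvPolynomial (Fin 7) k) * X 2 - X 4 ^ 2,
        X 1 * X 2 - X 5 ^ 2, X 2 ^ 2 - X 3 * X 2 - X 6 ^ 2} := by
  have hmap : Ideal.map
        (MvPolynomial.aeval (fun i : Fin 7 =>
          if i = 3 then (X 2 - X 3 : MvPolynomial (Fin 7) k) else X i))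
        (Ideal.span {(X 0 : MvPolynomial (Fin 7) k) * X 2 - X 4 ^ 2,
          X 1 * X 2 - X 5 ^ 2, X 3 * X 2 - X 6 ^ 2}) =
      Ideal.span {(X 0 : MvPolynomial (Fin 7) k) * X 2 - X 4 ^ 2,
        X 1 * X 2 - X 5 ^ 2, X 2 ^ 2 - X 3 * X 2 - X 6 ^ 2} := by
    rw [Ideal.map_span, Set.image_insert_eq, Set.image_insert_eq, Set.image_singleton]
    have e : ((X 2 : MvPolynomial (Fin 7) k) - X 3) * X 2 = X 2 ^ 2 - X 3 * X 2 := by ring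
    simp [e]
  refine ⟨?_, hmap⟩
  rw [← hmap]
  have hinv : (aeval (fun i : Fin 7 =>
      if i = 3 then (X 2 - X 3 : MvPolynomial (Fin 7) k) else X i)).comp
      (aeval (fun i : Fin 7 =>
        if i = 3 then (X 2 - X 3 : MvPolynomial (Fin 7) k) else X i)) =
      AlgHom.id k (MvPolynomial (Fin 7) k) := by
    ext1 i
    by_cases h : i = 3 <;> simp [h]
  have := toric_isPrime (k := k)
  exact Ideal.map_isPrime_of_equiv (AlgEquiv.ofAlgHom _ _ hinv hinv)
end

section
/- Let P be a homogeneous prime ideal in R = k[x_1,...,x_r] with dim(R/P) = 2. Fix a monomial order and suppose I = in(P) is Borel-fixed. Then I has the saturated chain property: for every non-minimal associated prime Q of R/I there exists an associated prime P' of R/I with P' ⊆ Q and dim(R/P') = dim(R/Q) + 1. -/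
open MvPolynomial

attribute [local instance] MvPolynomial.gradedAlgebra

/-- The leading exponent (multidegree) of a polynomial w.r.t. a monomial order. -/
noncomputable def MonomialOrder.leadExp {k : Type*} [Field k] {r : ℕ}
    (m : MonomialOrder (Fin r)) (f : MvPolynomial (Fin r) k) : Fin r →₀ ℕ :=
  m.toSyn.symm (f.support.sup fun d => m.toSyn d)

/-- The initial ideal of `P` w.r.t. a monomial order: the ideal generated by the leading
monomials of the nonzero elements of `P`. -/
noncomputable def MonomialOrder.initialIdeal {k : Type*} [Field k] {r : ℕ}
    (m : MonomialOrder (Fin r)) (P : Ideal (MvPolynomial (Fin r) k)) :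
    Ideal (MvPolynomial (Fin r) k) :=
  Ideal.span ((fun f => monomial (m.leadExp f) (1 : k)) '' {f | f ∈ P ∧ f ≠ 0})


theorem bf_dim_integral {A B : Type*} [CommRing A] [CommRing B] [Algebra A B]
    [Algebra.IsIntegral A B] (hinj : Function.Injective (algebraMap A B)) :
    ringKrullDim B = ringKrullDim A := by
  apply le_antisymm
  · refine Order.krullDim_le_of_strictMono (PrimeSpectrum.comap (algebraMap A B)) ?_
    intro p q hpq
    have := Ideal.IsIntegral.comap_lt_comap (R := A) (I := p.asIdeal) (J := q.asIdeal) hpq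
    exact this
  · refine iSup_le fun l => ?_
    have key : ∃ L : LTSeries (PrimeSpectrum B), L.length = l.length ∧
        PrimeSpectrum.comap (algebraMap A B) L.last = l.last := by
      induction l using RelSeries.inductionOn' with
      | singleton x =>
        obtain ⟨Q, _, hQ, hQ2⟩ := Ideal.exists_ideal_over_prime_of_isIntegral x.asIdeal (⊥ : Ideal B)
          (by rw [← RingHom.ker_eq_comap_bot, (RingHom.injective_iff_ker_eq_bot _).1 hinj]
              exact bot_le)
        exact ⟨RelSeries.singleton _ ⟨Q, hQ⟩, rfl, PrimeSpectrum.ext hQ2⟩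
      | snoc p x hx hp =>
        obtain ⟨L, hL, hlast⟩ := hp
        have hx' : p.last < x := hx
        obtain ⟨Q, hle, hQ, hQ2⟩ := Ideal.exists_ideal_over_prime_of_isIntegral x.asIdeal
          L.last.asIdeal (by
            have : (PrimeSpectrum.comap (algebraMap A B) L.last).asIdeal ≤ x.asIdeal := by
              rw [hlast]; exact hx'.le
            exact this)
        have hlt : L.last < ⟨Q, hQ⟩ := by
          refine lt_of_le_of_ne hle ?_
          intro h
          rw [h] at hlast
          have : p.last = x := by
            rw [← hlast]; exact PrimeSpectrum.ext hQ2
          exact hx'.ne this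
        refine ⟨L.snoc ⟨Q, hQ⟩ hlt, ?_, ?_⟩
        · simp [hL]
        · rw [RelSeries.last_snoc, RelSeries.last_snoc]
          exact PrimeSpectrum.ext hQ2
    obtain ⟨L, hL, _⟩ := key
    rw [← hL]
    exact Order.LTSeries.length_le_krullDim L

/-- dimension of a quotient finite over a polynomial subring -/
theorem bf_dim_surj {k : Type*} [Field k] {r : ℕ} (V : Finset (Fin r))
    {B : Type*} [CommRing B] (π : MvPolynomial (Fin r) k →+* B) (hπ : Function.Surjective π)
    (hP0 : ∀ f, π f = 0 → (∀ w ∈ f.support, ∀ v ∈ V, w v = 0) → f = 0)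
    (K : ℕ) (hgen : ∀ f : MvPolynomial (Fin r) k, ∃ s, π f = π s ∧
      ∀ w ∈ s.support, ∀ v ∈ V, w v < K) :
    ringKrullDim B = ((Vᶜ).card : ℕ) := by
  classical
  let A := MvPolynomial {a // a ∉ V} k
  let φ : A →+* B := π.comp
    (rename (Subtype.val : {a // a ∉ V} → Fin r) : A →ₐ[k] _).toRingHom
  let : Algebra A (B) := φ.toAlgebra
  have hφ : ∀ x : A, algebraMap A (B) x =
    π (rename Subtype.val x) := fun x => rfl
  have hinj : Function.Injective (algebraMap A (B)) := by
    rw [injective_iff_map_eq_zero]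
    intro x hx
    rw [hφ] at hx
    have := hP0 _ hx (by
      intro w hw v hv
      rw [support_rename_of_injective Subtype.val_injective] at hw
      obtain ⟨u, hu, rfl⟩ := Finset.mem_image.1 hw
      exact Finsupp.mapDomain_of_notMem_range _ _ (by simpa using hv))
    exact (map_eq_zero_iff _ (rename_injective _ Subtype.val_injective)).1 this
  have hfin : Module.Finite A (B) := by
    let E : Set (Fin r →₀ ℕ) := Set.Iic (Finsupp.equivFunOnFinite.symm fun _ => K)
    have hE : Set.Finite E := Set.finite_Iic _
    have : (⊤ : Submodule A B) = Submodule.span A ((fun u => π (monomial u (1:k))) '' E) := ?_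
    · exact ⟨Submodule.fg_def.2 ⟨_, hE.image _, this.symm⟩⟩
    rw [eq_comm, eq_top_iff]
    rintro z -
    obtain ⟨f, rfl⟩ := hπ z
    obtain ⟨s, hs, hsK⟩ := hgen f
    rw [hs, s.as_sum, map_sum]
    refine Submodule.sum_mem _ fun w hw => ?_
    have hmem : π (monomial (w.filter (· ∈ V)) (1:k)) ∈
      Submodule.span A ((fun u => π (monomial u (1:k))) '' E) := by
      refine Submodule.subset_span ⟨_, ?_, rfl⟩
      intro v
      simp only [Finsupp.filter_apply, Finsupp.equivFunOnFinite_symm_apply_apply]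
      split_ifs with h
      · exact (hsK w hw v h).le
      · exact Nat.zero_le _
    have := Submodule.smul_mem _ (monomial (w.subtypeDomain (· ∉ V)) (coeff w s) : A) hmem
    rw [Algebra.smul_def, hφ, ← map_mul, rename_monomial, monomial_mul] at this
    have hw2 : Finsupp.mapDomain Subtype.val (w.subtypeDomain (· ∉ V)) + w.filter (· ∈ V) = w := by
      ext v
      by_cases hv : v ∈ V
      · rw [Finsupp.add_apply, Finsupp.mapDomain_of_notMem_range _ _ (by simpa using hv)]
        simp [hv]
      · have := Finsupp.mapDomain_apply (f := (Subtype.val : {a // a ∉ V} → Fin r))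
          Subtype.val_injective (w.subtypeDomain (· ∉ V)) ⟨v, hv⟩
        rw [Finsupp.add_apply, this]
        simp [hv]
    rw [hw2, mul_one] at this
    exact this
  rw [bf_dim_integral hinj, MvPolynomial.ringKrullDim_of_isNoetherianRing, ringKrullDim_eq_zero_of_field, zero_add]
  congr 1
  rw [Nat.card_eq_fintype_card, Fintype.card_subtype]
  congr 2
  ext; simp

theorem bf_dim_quot {k : Type*} [Field k] {r : ℕ} (V : Finset (Fin r))
    (P : Ideal (MvPolynomial (Fin r) k))
    (hP0 : ∀ f ∈ P, (∀ w ∈ f.support, ∀ v ∈ V, w v = 0) → f = 0)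
    (K : ℕ) (hgen : ∀ f : MvPolynomial (Fin r) k, ∃ s, f - s ∈ P ∧
      ∀ w ∈ s.support, ∀ v ∈ V, w v < K) :
    ringKrullDim (MvPolynomial (Fin r) k ⧸ P) = ((Vᶜ).card : ℕ) := by
  refine bf_dim_surj V (Ideal.Quotient.mk P) Ideal.Quotient.mk_surjective ?_ K ?_
  · intro f hf
    exact hP0 f (Ideal.Quotient.eq_zero_iff_mem.1 hf)
  · intro f
    obtain ⟨s, hs, h⟩ := hgen f
    exact ⟨s, Ideal.Quotient.eq.2 hs, h⟩

/-- A polynomial with one term removed. -/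
theorem bf_support_sub {k : Type*} [Field k] {r : ℕ} (f : MvPolynomial (Fin r) k)
    (d : Fin r →₀ ℕ) : (f - monomial d (coeff d f)).support = f.support.erase d := by
  classical
  ext w
  rw [Finset.mem_erase, mem_support_iff, mem_support_iff, coeff_sub, coeff_monomial]
  by_cases h : d = w
  · subst h; simp
  · simp [h, Ne.symm h]

/-- Associated primes of monomial ideals are monomial. -/
theorem bf_assoc_monomial {k : Type*} [Field k] {r : ℕ} (m : MonomialOrder (Fin r))
    (I Q : Ideal (MvPolynomial (Fin r) k))
    (hMon : ∀ f, f ∈ I ↔ ∀ w ∈ f.support, monomial w (1 : k) ∈ I)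
    (hQ : IsAssociatedPrime Q (MvPolynomial (Fin r) k ⧸ I)) :
    ∃ f, (∀ g, g ∈ Q ↔ g * f ∈ I) ∧
      ∀ g ∈ Q, ∀ w ∈ g.support, monomial w (1 : k) ∈ Q := by
  classical
  rw [isAssociatedPrime_iff] at hQ
  obtain ⟨hQp, x, hx⟩ := hQ
  obtain ⟨f0, rfl⟩ := Ideal.Quotient.mk_surjective x
  have hf0 : ∀ g, g ∈ Q ↔ g * f0 ∈ I := by
    intro g
    rw [hx, Submodule.mem_colon_singleton, Submodule.mem_bot, ← Ideal.Quotient.eq_zero_iff_mem,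
      map_mul]
    rfl
  have hex : ∃ n, ∃ f, (∀ g, g ∈ Q ↔ g * f ∈ I) ∧ f.support.card = n := ⟨_, f0, hf0, rfl⟩
  obtain ⟨f, hf, hcard⟩ := Nat.find_spec hex
  have hmin : ∀ f', (∀ g, g ∈ Q ↔ g * f' ∈ I) → f.support.card ≤ f'.support.card := by
    intro f' hf'
    rw [hcard]
    exact Nat.find_min' hex ⟨f', hf', rfl⟩
  have hfne : f ≠ 0 := by
    rintro rfl
    apply hQp.ne_top
    rw [Ideal.eq_top_iff_one, hf]
    simp
  have hcI : ∀ (w : Fin r →₀ ℕ) (c : k), monomial w (1 : k) ∈ I → monomial w c ∈ I := by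
    intro w c h
    have : monomial w c = C c * monomial w (1 : k) := by rw [C_mul_monomial, mul_one]
    rw [this]; exact I.mul_mem_left _ h
  have hcQ : ∀ (w : Fin r →₀ ℕ) (c : k), monomial w (1 : k) ∈ Q → monomial w c ∈ Q := by
    intro w c h
    have : monomial w c = C c * monomial w (1 : k) := by rw [C_mul_monomial, mul_one]
    rw [this]; exact Q.mul_mem_left _ h
  have hlead : ∀ g ∈ Q, g ≠ 0 → monomial (m.degree g) (1 : k) ∈ Q := by
    intro g hg hgne
    by_contra hnot
    have h1 : monomial (m.degree g + m.degree f) (1 : k) ∈ I := by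
      refine (hMon _).1 ((hf g).1 hg) _ ?_
      rw [← m.degree_mul hgne hfne]
      exact m.degree_mem_support (mul_ne_zero hgne hfne)
    have h2 := hmin (monomial (m.degree g) (1 : k) *
      (f - monomial (m.degree f) (coeff (m.degree f) f))) (by
      intro h
      have h3 : h * (monomial (m.degree g) (1 : k) * monomial (m.degree f) (coeff (m.degree f) f))
          ∈ I := by
        rw [monomial_mul, one_mul]
        exact I.mul_mem_left _ (hcI _ _ h1)
      have h4 : h * (monomial (m.degree g) (1 : k) *
          (f - monomial (m.degree f) (coeff (m.degree f) f))) =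
          h * monomial (m.degree g) (1 : k) * f -
          h * (monomial (m.degree g) (1 : k) * monomial (m.degree f) (coeff (m.degree f) f)) := by
        ring
      rw [h4, Submodule.sub_mem_iff_left I h3, ← hf]
      exact ⟨fun hh => Q.mul_mem_right _ hh, fun hh => (hQp.mem_or_mem hh).resolve_right hnot⟩)
    have h5 : (monomial (m.degree g) (1 : k) *
      (f - monomial (m.degree f) (coeff (m.degree f) f))).support.card ≤
        (f - monomial (m.degree f) (coeff (m.degree f) f)).support.card := by
      refine (Finset.card_le_card (support_mul _ _)).trans ?_
      refine Finset.card_add_le.trans ?_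
      have : (monomial (m.degree g) (1 : k)).support.card ≤ 1 :=
        (Finset.card_le_card support_monomial_subset).trans (by simp)
      nlinarith
    rw [bf_support_sub, Finset.card_erase_of_mem (m.degree_mem_support hfne)] at h5
    have h6 : 0 < f.support.card := Finset.card_pos.2 ⟨_, m.degree_mem_support hfne⟩
    omega
  refine ⟨f, hf, ?_⟩
  have key : ∀ n, ∀ g ∈ Q, g.support.card = n → ∀ w ∈ g.support, monomial w (1 : k) ∈ Q := by
    intro n
    induction n using Nat.strong_induction_on with
    | _ n ih =>
      intro g hg hn w hw
      have hgne : g ≠ 0 := by rintro rfl; simp at hw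
      have hl := hlead g hg hgne
      by_cases hwd : w = m.degree g
      · rw [hwd]; exact hl
      · refine ih (g - monomial (m.degree g) (coeff (m.degree g) g)).support.card ?_
          (g - monomial (m.degree g) (coeff (m.degree g) g))
          (Q.sub_mem hg (hcQ _ _ hl)) rfl w ?_
        · rw [bf_support_sub, ← hn]
          exact Finset.card_erase_lt_of_mem (m.degree_mem_support hgne)
        · rw [bf_support_sub]
          exact Finset.mem_erase.2 ⟨hwd, hw⟩
  exact fun g hg => key _ g hg rfl

/-- The prime generated by the first `n` variables. -/
noncomputable def bfP (k : Type*) [Field k] (r n : ℕ) : Ideal (MvPolynomial (Fin r) k) :=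
  Ideal.span (X '' {a : Fin r | a.val < n})

theorem bf_mem_bfP {k : Type*} [Field k] {r n : ℕ} (g : MvPolynomial (Fin r) k) :
    g ∈ bfP k r n ↔ ∀ w ∈ g.support, ∃ a : Fin r, a.val < n ∧ w a ≠ 0 :=
  mem_ideal_span_X_image

theorem bf_bfP_mono {k : Type*} [Field k] {r n n' : ℕ} (h : n ≤ n') : bfP k r n ≤ bfP k r n' := by
  intro g hg
  rw [bf_mem_bfP] at *
  intro w hw
  obtain ⟨a, ha, h2⟩ := hg w hw
  exact ⟨a, ha.trans_le h, h2⟩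

theorem bf_dim_bfP {k : Type*} [Field k] {r n : ℕ} (hn : n ≤ r) :
    ringKrullDim (MvPolynomial (Fin r) k ⧸ bfP k r n) = ((r - n : ℕ) : WithBot ℕ∞) := by
  classical
  rw [bf_dim_quot (Finset.univ.filter fun a : Fin r => a.val < n) (bfP k r n) ?_ 1 ?_]
  · congr 2
    rw [Finset.card_compl, Fintype.card_fin, Fin.card_filter_val_lt, min_eq_right hn]
  · intro f hf h0
    rw [bf_mem_bfP] at hf
    by_contra hne
    obtain ⟨w, hw⟩ := support_nonempty.2 hne
    obtain ⟨a, ha, h2⟩ := hf w hw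
    exact h2 (h0 w hw a (by simpa using ha))
  · intro f
    refine ⟨∑ w ∈ f.support.filter (fun w => ∀ a : Fin r, a.val < n → w a = 0),
      monomial w (coeff w f), ?_, ?_⟩
    · nth_rewrite 1 [f.as_sum]
      rw [← Finset.sum_filter_add_sum_filter_not f.support
        (fun w => ∀ a : Fin r, a.val < n → w a = 0), add_sub_cancel_left]
      refine Ideal.sum_mem _ fun w hw => ?_
      rw [bf_mem_bfP]
      intro w' hw'
      have := Finset.mem_singleton.1 (support_monomial_subset hw')
      subst this
      have := (Finset.mem_filter.1 hw).2
      push Not at this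
      exact this
    · intro w hw v hv
      have := support_sum hw
      obtain ⟨w', hw', h⟩ := Finset.mem_biUnion.1 this
      have := Finset.mem_singleton.1 (support_monomial_subset h)
      subst this
      rw [(Finset.mem_filter.1 hw').2 v (by simpa using hv)]
      exact one_pos

/-- Borel moves between arbitrary variables. -/
theorem bf_borel {k : Type*} [Field k] {r : ℕ} (I : Ideal (MvPolynomial (Fin r) k))
    (hborel : ∀ (J : Fin r →₀ ℕ) (a : Fin r) (ha : a.val + 1 < r),
      monomial J (1 : k) ∈ I → 0 < J ⟨a.val + 1, ha⟩ →
      monomial (J + Finsupp.single a 1 - Finsupp.single ⟨a.val + 1, ha⟩ 1) (1 : k) ∈ I)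
    (w : Fin r →₀ ℕ) (a b : Fin r) (hab : a ≤ b)
    (h : monomial (w + Finsupp.single b 1) (1 : k) ∈ I) :
    monomial (w + Finsupp.single a 1) (1 : k) ∈ I := by
  obtain ⟨b, hb⟩ := b
  induction b with
  | zero =>
    have : a = ⟨0, hb⟩ := le_antisymm hab (Nat.zero_le _)
    rw [this]; exact h
  | succ b ih =>
    by_cases he : a = ⟨b + 1, hb⟩
    · rw [he]; exact h
    · have hle : a ≤ ⟨b, by omega⟩ := by
        have h1 : a.val ≤ b + 1 := hab
        have h2 : a.val ≠ b + 1 := fun h => he (Fin.ext h)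
        show a.val ≤ b
        omega
      refine ih (by omega) hle ?_
      have := hborel _ ⟨b, by omega⟩ hb h (by simp)
      convert this using 2
      rw [add_right_comm, add_tsub_cancel_right]

/-- Associated primes of Borel-fixed ideals. -/
theorem bf_assoc_struct {k : Type*} [Field k] {r : ℕ} (m : MonomialOrder (Fin r))
    (I Q : Ideal (MvPolynomial (Fin r) k))
    (hMon : ∀ f, f ∈ I ↔ ∀ w ∈ f.support, monomial w (1 : k) ∈ I)
    (hmove : ∀ (w : Fin r →₀ ℕ) (a b : Fin r), a ≤ b →
      monomial (w + Finsupp.single b 1) (1 : k) ∈ I → monomial (w + Finsupp.single a 1) (1 : k) ∈ I)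
    (hQ : IsAssociatedPrime Q (MvPolynomial (Fin r) k ⧸ I)) :
    ∃ n ≤ r, Q = bfP k r n := by
  classical
  obtain ⟨f, hf, hmon⟩ := bf_assoc_monomial m I Q hMon hQ
  have hQp := hQ.isPrime
  have hlow : ∀ a b : Fin r, a ≤ b → (X b : MvPolynomial (Fin r) k) ∈ Q →
      (X a : MvPolynomial (Fin r) k) ∈ Q := by
    intro a b hab hb
    rw [hf, hMon] at hb ⊢
    intro w hw
    rw [support_X_mul] at hw
    obtain ⟨u, hu, rfl⟩ := Finset.mem_map.1 hw
    have h1 := hb (Finsupp.single b 1 + u) (by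
      rw [support_X_mul]; exact Finset.mem_map.2 ⟨u, hu, rfl⟩)
    rw [add_comm] at h1
    have := hmove _ a b hab h1
    rw [add_comm] at this
    exact this
  refine ⟨(Finset.univ.filter fun a : Fin r => (X a : MvPolynomial (Fin r) k) ∈ Q).sup
    (fun a => a.val + 1), Finset.sup_le fun a _ => a.isLt, ?_⟩
  have hv : ∀ a : Fin r, a.val < (Finset.univ.filter fun a : Fin r =>
      (X a : MvPolynomial (Fin r) k) ∈ Q).sup (fun a => a.val + 1) ↔
      (X a : MvPolynomial (Fin r) k) ∈ Q := by
    intro a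
    rw [Finset.lt_sup_iff]
    constructor
    · rintro ⟨b, hb, hab⟩
      exact hlow a b (Nat.lt_succ_iff.1 hab) (Finset.mem_filter.1 hb).2
    · intro h
      exact ⟨a, by simpa using h, Nat.lt_succ_self _⟩
  apply le_antisymm
  · intro g hg
    rw [bf_mem_bfP]
    intro w hw
    have h1 := hmon g hg w hw
    rw [monomial_eq, C_1, one_mul, Finsupp.prod, hQp.prod_mem_iff] at h1
    obtain ⟨a, ha, h2⟩ := h1
    exact ⟨a, (hv a).2 (hQp.mem_of_pow_mem _ h2), Finsupp.mem_support_iff.1 ha⟩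
  · refine Ideal.span_le.2 ?_
    rintro _ ⟨a, ha, rfl⟩
    exact (hv a).1 ha

/-- The key step: `J`, the saturation of the initial ideal, agrees with the initial ideal. -/
theorem bf_key {k : Type*} [Field k] {r : ℕ} (m : MonomialOrder (Fin r))
    (P I : Ideal (MvPolynomial (Fin r) k)) (hP : P.IsPrime)
    (hhom : ∀ f ∈ P, ∀ d, homogeneousComponent d f ∈ P)
    (hlead : ∀ f ∈ P, f ≠ 0 → monomial (m.degree f) (1 : k) ∈ I)
    (hstd : ∀ f, ∃ s, f - s ∈ P ∧ ∀ w ∈ s.support, monomial w (1 : k) ∉ I)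
    (J : Set (Fin r →₀ ℕ)) (hIJ : ∀ w, monomial w (1 : k) ∈ I → w ∈ J)
    (hup : ∀ w v, w ∈ J → w + v ∈ J) (a b : Fin r) (hab : a ≠ b)
    (hda : ∀ w, w + Finsupp.single a 1 ∈ J → w ∈ J)
    (hdb : ∀ w, w + Finsupp.single b 1 ∈ J → w ∈ J)
    (h0 : 0 ∉ J) (hfin : {w | w ∈ J ∧ monomial w (1 : k) ∉ I}.Finite) :
    ∀ w ∈ J, monomial w (1 : k) ∈ I := by
  classical
  have hdn : ∀ c : Fin r, (∀ w, w + Finsupp.single c 1 ∈ J → w ∈ J) →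
      ∀ N w, w + Finsupp.single c N ∈ J → w ∈ J := by
    intro c hc N
    induction N with
    | zero => intro w hw; simpa using hw
    | succ N ih =>
      intro w hw
      rw [Finsupp.single_add, ← add_assoc] at hw
      exact ih _ (hc _ hw)
  -- the intersection of `P` with the span of monomials outside `J`
  have hPS : ∀ f ∈ P, (∀ w ∈ f.support, w ∉ J) → f = 0 := by
    intro f hf hw
    by_contra hne
    exact hw _ (m.degree_mem_support hne) (hIJ _ (hlead f hf hne))
  obtain ⟨N, hN⟩ : ∃ N, ∀ w ∈ J, monomial w (1 : k) ∉ I → w.degree < N := by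
    refine ⟨(hfin.toFinset.sup fun w => w.degree) + 1, fun w hw hwI => ?_⟩
    exact Nat.lt_succ_of_le (Finset.le_sup (f := fun w : Fin r →₀ ℕ => w.degree)
      (hfin.mem_toFinset.2 ⟨hw, hwI⟩))
  -- homogeneous polynomials of large degree
  have hbig : ∀ d f, N ≤ d → f.IsHomogeneous d → ∃ s, f - s ∈ P ∧ ∀ w ∈ s.support, w ∉ J := by
    intro d f hd hf
    obtain ⟨s, hs, hsI⟩ := hstd f
    refine ⟨homogeneousComponent d s, ?_, ?_⟩
    · have := hhom _ hs d
      rw [map_sub, homogeneousComponent_of_mem ((mem_homogeneousSubmodule _ _).2 hf),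
        if_pos rfl] at this
      exact this
    · intro w hw hwJ
      have hc : coeff w (homogeneousComponent d s) ≠ 0 := mem_support_iff.1 hw
      rw [coeff_homogeneousComponent] at hc
      have hwd : w.degree = d := by
        by_contra h
        simp [h] at hc
      rw [if_pos hwd] at hc
      have := hN w hwJ (hsI w (mem_support_iff.2 hc))
      omega
  have hXmul : ∀ (c : Fin r) (f : MvPolynomial (Fin r) k) w,
      coeff (w + Finsupp.single c N) (X c ^ N * f) = coeff w f := by
    intro c f w
    rw [X_pow_eq_monomial, add_comm, coeff_monomial_mul, one_mul]
  -- multiplication preserves `S`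
  have hSmul : ∀ (c : Fin r), (∀ w, w + Finsupp.single c 1 ∈ J → w ∈ J) →
      ∀ s : MvPolynomial (Fin r) k, (∀ w ∈ s.support, w ∉ J) →
      ∀ w ∈ (X c ^ N * s).support, w ∉ J := by
    intro c hc s hs w hw hwJ
    rw [mem_support_iff, X_pow_eq_monomial, coeff_monomial_mul'] at hw
    split_ifs at hw with hle
    · rw [one_mul] at hw
      refine hs _ (mem_support_iff.2 hw) ?_
      refine hdn c hc N _ ?_
      rwa [tsub_add_cancel_of_le hle]
    · exact hw rfl
  have hall : ∀ z : Fin r →₀ ℕ, ∃ s, monomial z (1 : k) - s ∈ P ∧ ∀ w ∈ s.support, w ∉ J := by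
    intro z
    have hhomz : ∀ c : Fin r, (X c ^ N * monomial z (1 : k)).IsHomogeneous (N + z.degree) := by
      intro c
      exact (isHomogeneous_X_pow c N).mul (isHomogeneous_monomial _ rfl)
    obtain ⟨F, hF, hFJ⟩ := hbig _ _ (Nat.le_add_right _ _) (hhomz a)
    obtain ⟨G, hG, hGJ⟩ := hbig _ _ (Nat.le_add_right _ _) (hhomz b)
    have hFG : X b ^ N * F - X a ^ N * G = 0 := by
      apply hPS
      · have : X b ^ N * F - X a ^ N * G =
            X a ^ N * (X b ^ N * monomial z (1 : k) - G) -
            X b ^ N * (X a ^ N * monomial z (1 : k) - F) := by ring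
        rw [this]
        exact P.sub_mem (P.mul_mem_left _ hG) (P.mul_mem_left _ hF)
      · intro w hw
        rcases Finset.mem_union.1 (support_sub _ _ _ hw) with h | h
        · exact hSmul b hdb F hFJ w h
        · exact hSmul a hda G hGJ w h
    have hdvd : (X a : MvPolynomial (Fin r) k) ^ N ∣ X b ^ N * F :=
      ⟨G, sub_eq_zero.1 hFG⟩
    have hXa : Prime (X a : MvPolynomial (Fin r) k) := X_prime
    have hdvdF : (X a : MvPolynomial (Fin r) k) ^ N ∣ F := by
      refine hXa.pow_dvd_of_dvd_mul_left N ?_ hdvd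
      intro h
      have := hXa.dvd_of_dvd_pow h
      rw [X_dvd_X] at this
      exact hab this
    obtain ⟨H, rfl⟩ := hdvdF
    refine ⟨H, ?_, ?_⟩
    · rw [← mul_sub] at hF
      refine (hP.mem_or_mem hF).resolve_left ?_
      intro hXP
      have : (X a : MvPolynomial (Fin r) k) ^ N = 0 := by
        refine hPS _ hXP ?_
        have := hSmul a hda 1 (by
          intro w hw
          have : w = 0 := by
            have h1 := hw
            rw [← C_1] at h1
            exact Finset.mem_singleton.1 (support_monomial_subset h1)
          rw [this]; exact h0)
        rwa [mul_one] at this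
      exact pow_ne_zero N (X_ne_zero a) this
    · intro w hw hwJ
      refine hFJ (w + Finsupp.single a N) ?_ (hup _ _ hwJ)
      rw [mem_support_iff, hXmul]
      exact mem_support_iff.1 hw
  intro w hw
  obtain ⟨s, hs, hsJ⟩ := hall w
  have hcw : coeff w s = 0 := by
    by_contra h
    exact hsJ w (mem_support_iff.2 h) hw
  have hne : monomial w (1 : k) - s ≠ 0 := by
    intro h
    have := congrArg (coeff w) h
    simp [hcw] at this
  have hd := m.degree_mem_support hne
  have hI := hlead _ hs hne
  rcases Finset.mem_union.1 (support_sub _ _ _ hd) with h | h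
  · have := Finset.mem_singleton.1 (support_monomial_subset h)
    rwa [this] at hI
  · exact absurd (hIJ _ hI) (hsJ _ h)

theorem bf_X_mem {k : Type*} [Field k] {r n : ℕ} (c : Fin r) :
    (X c : MvPolynomial (Fin r) k) ∈ bfP k r n ↔ c.val < n := by
  classical
  constructor
  · intro h
    rw [bf_mem_bfP] at h
    obtain ⟨a, ha, h2⟩ := h (Finsupp.single c 1) (by simp [support_X])
    by_cases hac : c = a
    · rw [hac]; exact ha
    · simp [hac] at h2
  · intro h
    exact Ideal.subset_span ⟨c, h, rfl⟩

/-- If the prime of the first `n0 + 1` variables is not associated then neither is the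
maximal ideal. -/
theorem bf_max {k : Type*} [Field k] {r : ℕ} (m : MonomialOrder (Fin r))
    (P I : Ideal (MvPolynomial (Fin r) k)) (hP : P.IsPrime)
    (hhom : ∀ f ∈ P, ∀ d, homogeneousComponent d f ∈ P)
    (hlead : ∀ f ∈ P, f ≠ 0 → monomial (m.degree f) (1 : k) ∈ I)
    (hstd : ∀ f, ∃ s, f - s ∈ P ∧ ∀ w ∈ s.support, monomial w (1 : k) ∉ I)
    (hMon : ∀ f, f ∈ I ↔ ∀ w ∈ f.support, monomial w (1 : k) ∈ I)
    (hmove : ∀ (w : Fin r →₀ ℕ) (a b : Fin r), a ≤ b →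
      monomial (w + Finsupp.single b 1) (1 : k) ∈ I → monomial (w + Finsupp.single a 1) (1 : k) ∈ I)
    (n0 : ℕ) (hr : r = n0 + 2) (hIp : I ≤ bfP k r n0) (K : ℕ) (hK : (bfP k r n0) ^ K ≤ I)
    (hmax : IsAssociatedPrime (bfP k r r) (MvPolynomial (Fin r) k ⧸ I)) :
    IsAssociatedPrime (bfP k r (n0 + 1)) (MvPolynomial (Fin r) k ⧸ I) := by
  classical
  by_contra hno
  let a : Fin r := ⟨n0, by omega⟩
  let b : Fin r := ⟨n0 + 1, by omega⟩
  have hab : a ≠ b := by intro h; have := congrArg Fin.val h; simp [a, b] at this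
  have hable : a ≤ b := Nat.le_succ _
  have hIup : ∀ w v : Fin r →₀ ℕ, monomial w (1 : k) ∈ I → monomial (w + v) (1 : k) ∈ I := by
    intro w v h
    have : monomial (w + v) (1 : k) = monomial w 1 * monomial v 1 := by
      rw [monomial_mul, one_mul]
    rw [this]; exact I.mul_mem_right _ h
  have hIle : ∀ w v : Fin r →₀ ℕ, w ≤ v → monomial w (1 : k) ∈ I → monomial v (1 : k) ∈ I := by
    intro w v h hw
    rw [← add_tsub_cancel_of_le h]
    exact hIup _ _ hw
  let T : ℕ →o Ideal (MvPolynomial (Fin r) k) :=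
    { toFun := fun n => Submodule.comap (LinearMap.mulLeft (MvPolynomial (Fin r) k) (X b ^ n)) I
      monotone' := by
        intro n n' hnn f hf
        have hf' : X b ^ n * f ∈ I := hf
        show X b ^ n' * f ∈ I
        obtain ⟨e, rfl⟩ := Nat.exists_eq_add_of_le hnn
        rw [pow_add, mul_comm (X b ^ n), mul_assoc]
        exact I.mul_mem_left _ hf' }
  have hT : ∀ n f, f ∈ T n ↔ X b ^ n * f ∈ I := fun n f => Iff.rfl
  obtain ⟨N, hN⟩ := monotone_stabilizes_iff_noetherian.2
    (inferInstance : IsNoetherian (MvPolynomial (Fin r) k) (MvPolynomial (Fin r) k)) T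
  have hTmon : ∀ n (w : Fin r →₀ ℕ), monomial w (1 : k) ∈ T n ↔
      monomial (w + Finsupp.single b n) (1 : k) ∈ I := by
    intro n w
    rw [hT, X_pow_eq_monomial, monomial_mul, one_mul, add_comm]
  let J : Set (Fin r →₀ ℕ) := {w | monomial w (1 : k) ∈ T N}
  have hJ : ∀ w, w ∈ J ↔ monomial (w + Finsupp.single b N) (1 : k) ∈ I := hTmon N
  have hup : ∀ w v, w ∈ J → w + v ∈ J := by
    intro w v h
    rw [hJ] at h ⊢
    rw [add_right_comm]
    exact hIup _ _ h
  have hIJ : ∀ w, monomial w (1 : k) ∈ I → w ∈ J := by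
    intro w h
    rw [hJ]
    exact hIup _ _ h
  have hXT : ∀ f, X b * f ∈ T N → f ∈ T N := by
    intro f hf
    rw [hN (N + 1) (Nat.le_succ _), hT, pow_succ, mul_assoc]
    exact hf
  have hdb : ∀ w, w + Finsupp.single b 1 ∈ J → w ∈ J := by
    intro w hw
    apply hXT
    have : (X b : MvPolynomial (Fin r) k) * monomial w 1 =
      monomial (w + Finsupp.single b 1) 1 := by
      rw [X, monomial_mul, one_mul, add_comm]
    rw [this]; exact hw
  have hda : ∀ w, w + Finsupp.single a 1 ∈ J → w ∈ J := by
    intro w hw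
    by_contra hwJ
    have hne : Ideal.Quotient.mk (T N) (monomial w (1 : k)) ≠ 0 := by
      intro h
      have h' : monomial w (1 : k) ∈ T N := Ideal.Quotient.eq_zero_iff_mem.1 h
      exact hwJ h'
    obtain ⟨q, hq, hle⟩ := exists_le_isAssociatedPrime_of_isNoetherianRing
      (MvPolynomial (Fin r) k) _ hne
    have hXa : (X a : MvPolynomial (Fin r) k) ∈ q := by
      apply hle
      rw [Submodule.mem_colon_singleton, Submodule.mem_bot]
      have : Ideal.Quotient.mk (T N) (X a * monomial w (1 : k)) = 0 := by
        rw [Ideal.Quotient.eq_zero_iff_mem]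
        have : (X a : MvPolynomial (Fin r) k) * monomial w 1 =
          monomial (w + Finsupp.single a 1) 1 := by
          rw [X, monomial_mul, one_mul, add_comm]
        rw [this]; exact hw
      rw [map_mul] at this
      exact this
    rw [isAssociatedPrime_iff] at hq
    obtain ⟨hqp, x, hx⟩ := hq
    obtain ⟨f, rfl⟩ := Ideal.Quotient.mk_surjective x
    have hf : ∀ g, g ∈ q ↔ g * f ∈ T N := by
      intro g
      rw [hx, Submodule.mem_colon_singleton, Submodule.mem_bot, ← Ideal.Quotient.eq_zero_iff_mem,
        map_mul]
      rfl
    have hXb : (X b : MvPolynomial (Fin r) k) ∉ q := by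
      intro h
      rw [hf] at h
      apply hqp.ne_top
      rw [Ideal.eq_top_iff_one, hf, one_mul]
      exact hXT _ h
    have hqI : IsAssociatedPrime q (MvPolynomial (Fin r) k ⧸ I) := by
      rw [isAssociatedPrime_iff]
      refine ⟨hqp, Ideal.Quotient.mk I (X b ^ N * f), ?_⟩
      ext g
      rw [hf, hT, Submodule.mem_colon_singleton, Submodule.mem_bot, mul_left_comm,
        ← Ideal.Quotient.eq_zero_iff_mem, map_mul]
      rfl
    obtain ⟨n, hn, rfl⟩ := bf_assoc_struct m I q hMon hmove hqI
    rw [bf_X_mem] at hXa hXb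
    have : n = n0 + 1 := by
      simp only [a, b] at hXa hXb
      omega
    rw [this] at hqI
    exact hno hqI
  have hdn : ∀ c : Fin r, (∀ w, w + Finsupp.single c 1 ∈ J → w ∈ J) →
      ∀ N w, w + Finsupp.single c N ∈ J → w ∈ J := by
    intro c hc N
    induction N with
    | zero => intro w hw; simpa using hw
    | succ N ih =>
      intro w hw
      rw [Finsupp.single_add, ← add_assoc] at hw
      exact ih _ (hc _ hw)
  have h0 : (0 : Fin r →₀ ℕ) ∉ J := by
    intro h
    rw [hJ] at h
    have := hIp h
    rw [bf_mem_bfP] at this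
    obtain ⟨c, hc, h2⟩ := this (0 + Finsupp.single b N) (by simp)
    have hbc : b ≠ c := by
      intro h; rw [← h] at hc; simp [b] at hc
    simp [hbc] at h2
  have hmoves : ∀ n w, monomial (w + Finsupp.single b n) (1 : k) ∈ I →
      monomial (w + Finsupp.single a n) (1 : k) ∈ I := by
    intro n
    induction n with
    | zero => intro w hw; simpa using hw
    | succ n ih =>
      intro w hw
      rw [Finsupp.single_add, ← add_assoc] at hw
      have := hmove _ a b hable hw
      rw [add_right_comm] at this
      have := ih _ this
      rw [add_right_comm, add_assoc, ← Finsupp.single_add] at this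
      exact this
  have hfin : {w | w ∈ J ∧ monomial w (1 : k) ∉ I}.Finite := by
    refine (Set.finite_Iic (Finsupp.equivFunOnFinite.symm fun _ : Fin r => K + N)).subset ?_
    rintro w ⟨hwJ, hwI⟩
    intro v
    rw [Finsupp.equivFunOnFinite_symm_apply_apply]
    by_contra! hlt
    by_cases hv : v.val < n0
    · apply hwI
      refine hIle (Finsupp.single v K) w ?_ ?_
      · rw [Finsupp.single_le_iff]; omega
      · rw [← X_pow_eq_monomial]
        exact hK (Ideal.pow_mem_pow ((bf_X_mem v).2 hv) K)
    · have hsplit : ∀ c : Fin r, (∀ w, w + Finsupp.single c 1 ∈ J → w ∈ J) →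
          monomial (w.erase c + Finsupp.single b N) (1 : k) ∈ I := by
        intro c hc
        rw [← hJ]
        apply hdn c hc (w c)
        rw [Finsupp.erase_add_single]
        exact hwJ
      have hfinish : ∀ c : Fin r, N ≤ w c →
          monomial (w.erase c + Finsupp.single c N) (1 : k) ∈ I → False := by
        intro c hc h
        apply hwI
        refine hIle _ w ?_ h
        nth_rewrite 2 [← Finsupp.erase_add_single c w]
        exact add_le_add le_rfl (Finsupp.single_mono hc)
      have hvab : v = a ∨ v = b := by
        have := v.isLt
        by_cases h : v.val = n0
        · left; exact Fin.ext h
        · right; apply Fin.ext; simp only [b]; omega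
      rcases hvab with rfl | rfl
      · exact hfinish _ (by omega) (hmoves _ _ (hsplit _ hda))
      · exact hfinish _ (by omega) (hsplit _ hdb)
  have hkey := bf_key m P I hP hhom hlead hstd J hIJ hup a b hab hda hdb h0 hfin
  obtain ⟨f, hf, -⟩ := bf_assoc_monomial m I _ hMon hmax
  have hXb : X b * f ∈ I := (hf _).1 ((bf_X_mem b).2 b.isLt)
  apply hmax.isPrime.ne_top
  rw [Ideal.eq_top_iff_one, hf, one_mul, hMon]
  intro w hw
  apply hkey
  apply hdb
  apply hIJ
  refine (hMon _).1 hXb _ ?_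
  rw [support_X_mul]
  exact Finset.mem_map.2 ⟨w, hw, add_comm _ _⟩

/-- Main theorem: if `P` is a homogeneous prime with `dim(R/P) = 2` and
`I = in(P)` is Borel-fixed, then `I` has the saturated chain property. -/
theorem borel_fixed_initial_ideal_saturated_chain {k : Type*} [Field k] {r : ℕ}
    (P : Ideal (MvPolynomial (Fin r) k)) (hP : P.IsPrime)
    (hhom : P.IsHomogeneous (homogeneousSubmodule (Fin r) k))
    (hdim : ringKrullDim (MvPolynomial (Fin r) k ⧸ P) = 2)
    (m : MonomialOrder (Fin r)) (I : Ideal (MvPolynomial (Fin r) k))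
    (hI : I = m.initialIdeal P)
    (hborel : ∀ (J : Fin r →₀ ℕ) (a : Fin r) (ha : a.val + 1 < r),
      monomial J (1 : k) ∈ I → 0 < J ⟨a.val + 1, ha⟩ →
      monomial (J + Finsupp.single a 1 - Finsupp.single ⟨a.val + 1, ha⟩ 1) (1 : k) ∈ I) :
    ∀ Q : Ideal (MvPolynomial (Fin r) k),
      IsAssociatedPrime Q (MvPolynomial (Fin r) k ⧸ I) → Q ∉ I.minimalPrimes →
      ∃ P' : Ideal (MvPolynomial (Fin r) k),
        IsAssociatedPrime P' (MvPolynomial (Fin r) k ⧸ I) ∧ P' ≤ Q ∧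
        ringKrullDim (MvPolynomial (Fin r) k ⧸ P') =
          ringKrullDim (MvPolynomial (Fin r) k ⧸ Q) + 1 := by
  classical
  intro Q hQ hQmin
  have hst : ∀ w, monomial w (1 : k) ∈ I ↔ ∃ f ∈ P, f ≠ 0 ∧ m.degree f ≤ w := by
    intro w
    have hI' : I = Ideal.span ((fun s => monomial s (1 : k)) '' (m.degree '' {f | f ∈ P ∧ f ≠ 0})) := by
      rw [hI, Set.image_image]; rfl
    rw [hI', mem_ideal_span_monomial_image]
    constructor
    · intro h
      obtain ⟨_, ⟨f, ⟨hf, hne⟩, rfl⟩, hle⟩ := h w (by simp)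
      exact ⟨f, hf, hne, hle⟩
    · rintro ⟨f, hf, hne, hle⟩ w' hw'
      have := Finset.mem_singleton.1 (support_monomial_subset hw')
      subst this
      exact ⟨_, ⟨f, ⟨hf, hne⟩, rfl⟩, hle⟩
  have hMon : ∀ f, f ∈ I ↔ ∀ w ∈ f.support, monomial w (1 : k) ∈ I := by
    intro g
    simp_rw [hst]
    have hI' : I = Ideal.span ((fun s => monomial s (1 : k)) '' (m.degree '' {f | f ∈ P ∧ f ≠ 0})) := by
      rw [hI, Set.image_image]; rfl
    rw [hI', mem_ideal_span_monomial_image]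
    refine forall₂_congr fun w _ => ?_
    constructor
    · rintro ⟨_, ⟨f, ⟨hf, hne⟩, rfl⟩, hle⟩
      exact ⟨f, hf, hne, hle⟩
    · rintro ⟨f, hf, hne, hle⟩
      exact ⟨_, ⟨f, ⟨hf, hne⟩, rfl⟩, hle⟩
  have hlead : ∀ f ∈ P, f ≠ 0 → monomial (m.degree f) (1 : k) ∈ I :=
    fun f hf hne => (hst _).2 ⟨f, hf, hne, le_rfl⟩
  have hstd : ∀ f, ∃ s, f - s ∈ P ∧ ∀ w ∈ s.support, monomial w (1 : k) ∉ I := by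
    intro f
    obtain ⟨g, s, hfs, -, hs⟩ := m.div_set (B := {f | f ∈ P ∧ f ≠ 0})
      (fun b hb => isUnit_iff_ne_zero.2 (m.leadingCoeff_ne_zero_iff.2 hb.2)) f
    refine ⟨s, ?_, ?_⟩
    · rw [hfs, add_sub_cancel_right, Finsupp.linearCombination_apply]
      exact Ideal.sum_mem _ fun b _ => P.mul_mem_left _ b.2.1
    · intro w hw hwI
      obtain ⟨f', hf', hne, hle⟩ := (hst w).1 hwI
      exact hs w hw f' ⟨hf', hne⟩ hle
  have hhom' : ∀ f ∈ P, ∀ d, homogeneousComponent d f ∈ P := by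
    intro f hf d
    have := hhom d hf
    rw [← decomposition.decompose'_apply]
    exact this
  have hmove := bf_borel I hborel
  have hItop : I ≠ ⊤ := by
    intro h
    have h1 : monomial (0 : Fin r →₀ ℕ) (1 : k) ∈ I := by rw [h]; trivial
    obtain ⟨f, hf, hne, hle⟩ := (hst 0).1 h1
    have hd : m.degree f = 0 := le_antisymm hle bot_le
    have hc := m.degree_eq_zero_iff.1 hd
    rw [hc] at hf
    have hu : IsUnit (C (m.leadingCoeff f) : MvPolynomial (Fin r) k) :=
      (isUnit_iff_ne_zero.2 (m.leadingCoeff_ne_zero_iff.2 hne)).map C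
    exact hP.ne_top (Ideal.eq_top_of_isUnit_mem _ hf hu)
  have hminass : ∀ q ∈ I.minimalPrimes, IsAssociatedPrime q (MvPolynomial (Fin r) k ⧸ I) := by
    intro q hq
    apply Module.associatedPrimes.minimalPrimes_annihilator_subset_associatedPrimes
      (MvPolynomial (Fin r) k) (MvPolynomial (Fin r) k ⧸ I)
    rw [Ideal.annihilator_quotient]
    exact hq
  obtain ⟨p, hp⟩ := Ideal.nonempty_minimalPrimes hItop
  have hpass := hminass p hp
  obtain ⟨n0, hn0, rfl⟩ := bf_assoc_struct m I p hMon hmove hpass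
  have hIle : ∀ q, IsAssociatedPrime q (MvPolynomial (Fin r) k ⧸ I) → I ≤ q := by
    intro q hq
    have := hq.annihilator_le
    rw [Submodule.annihilator_top, Ideal.annihilator_quotient] at this
    exact this
  have hple : ∀ q, IsAssociatedPrime q (MvPolynomial (Fin r) k ⧸ I) → bfP k r n0 ≤ q := by
    intro q hq
    obtain ⟨n, hn, rfl⟩ := bf_assoc_struct m I q hMon hmove hq
    rcases le_total n0 n with h | h
    · exact bf_bfP_mono h
    · exact hp.2 ⟨hq.isPrime, hIle _ hq⟩ (bf_bfP_mono h)
  have hrad : I.radical = bfP k r n0 := by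
    rw [← Ideal.sInf_minimalPrimes]
    exact le_antisymm (sInf_le hp) (le_sInf fun q hq => hple q (hminass q hq))
  obtain ⟨K, hK⟩ := Ideal.exists_radical_pow_le_of_fg I (IsNoetherian.noetherian _)
  rw [hrad] at hK
  have hIp : I ≤ bfP k r n0 := hIle _ hpass
  have hdim2 := bf_dim_quot (Finset.univ.filter fun a : Fin r => a.val < n0) P (by
    intro f hf h0
    by_contra hne
    have := hIp (hlead f hf hne)
    rw [bf_mem_bfP] at this
    obtain ⟨a, ha, h2⟩ := this (m.degree f) (by simp)
    exact h2 (h0 _ (m.degree_mem_support hne) a (by simpa using ha))) K (by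
    intro f
    obtain ⟨s, hs, hsI⟩ := hstd f
    refine ⟨s, hs, fun w hw v hv => ?_⟩
    by_contra! hle
    apply hsI w hw
    have h1 : monomial (Finsupp.single v K) (1 : k) ∈ I := by
      rw [← X_pow_eq_monomial]
      exact hK (Ideal.pow_mem_pow ((bf_X_mem v).2 (by simpa using hv)) K)
    obtain ⟨f', hf', hne, hle'⟩ := (hst _).1 h1
    exact (hst _).2 ⟨f', hf', hne, hle'.trans (Finsupp.single_le_iff.2 hle)⟩)
  rw [hdim, Finset.card_compl, Fintype.card_fin, Fin.card_filter_val_lt, min_eq_right hn0] at hdim2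
  have hr2 : 2 = r - n0 := by exact_mod_cast hdim2
  obtain ⟨n, hn, rfl⟩ := bf_assoc_struct m I Q hMon hmove hQ
  have hne : n ≠ n0 := by rintro rfl; exact hQmin hp
  have hlt : n0 < n := by
    by_contra! hle
    have h1 : bfP k r n = bfP k r n0 := le_antisymm (bf_bfP_mono hle) (hple _ hQ)
    rw [h1] at hQmin
    exact hQmin hp
  by_cases hn1 : n = n0 + 1
  · refine ⟨bfP k r n0, hpass, bf_bfP_mono hlt.le, ?_⟩
    rw [bf_dim_bfP hn0, bf_dim_bfP hn]
    have : r - n0 = (r - n) + 1 := by omega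
    rw [this]; push_cast; rfl
  · have hnr : n = r := by omega
    subst hnr
    refine ⟨bfP k n (n0 + 1), bf_max m P I hP hhom' hlead hstd hMon hmove n0 (by omega) hIp K hK hQ,
      bf_bfP_mono (by omega), ?_⟩
    rw [bf_dim_bfP (by omega), bf_dim_bfP hn]
    have : n - (n0 + 1) = (n - n) + 1 := by omega
    rw [this]; push_cast; rfl
end

section
/- Let P be a homogeneous prime ideal in R = k[x_1,...,x_r] with dim(R/P) = 2, and suppose I = in(P) (for some fixed monomial order) is Borel-fixed. If the maximal ideal (x_1,...,x_r) is an associated prime of R/I, then (x_1,...,x_{r-1}) is also an associated prime of R/I. -/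
open MvPolynomial

attribute [local instance] MvPolynomial.gradedAlgebra

section Helpers

variable {k : Type*} [Field k] {r : ℕ}

theorem aux_mem_initialIdeal (m : MonomialOrder (Fin r)) (P : Ideal (MvPolynomial (Fin r) k))
    (f : MvPolynomial (Fin r) k) :
    f ∈ m.initialIdeal P ↔ ∀ d ∈ f.support, ∃ g ∈ P, g ≠ 0 ∧ m.degree g ≤ d := by
  have h : m.initialIdeal P = Ideal.span ((fun s => monomial s (1 : k)) ''
      (m.degree '' {f | f ∈ P ∧ f ≠ 0})) := by
    rw [Set.image_image]; rfl
  rw [h, mem_ideal_span_monomial_image]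
  simp [and_assoc]

theorem aux_mon_mem (m : MonomialOrder (Fin r)) (P : Ideal (MvPolynomial (Fin r) k))
    (d : Fin r →₀ ℕ) :
    monomial d (1 : k) ∈ m.initialIdeal P ↔ ∃ g ∈ P, g ≠ 0 ∧ m.degree g ≤ d := by
  classical
  rw [aux_mem_initialIdeal]
  simp [support_monomial]

theorem aux_mem_iff_mon (m : MonomialOrder (Fin r)) (P : Ideal (MvPolynomial (Fin r) k))
    (f : MvPolynomial (Fin r) k) :
    f ∈ m.initialIdeal P ↔ ∀ d ∈ f.support, monomial d (1 : k) ∈ m.initialIdeal P := by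
  simp only [aux_mon_mem]
  exact aux_mem_initialIdeal m P f

theorem aux_mon_mono (m : MonomialOrder (Fin r)) (P : Ideal (MvPolynomial (Fin r) k))
    {d e : Fin r →₀ ℕ} (h : d ≤ e) (hd : monomial d (1 : k) ∈ m.initialIdeal P) :
    monomial e (1 : k) ∈ m.initialIdeal P := by
  rw [aux_mon_mem] at *
  obtain ⟨g, a, b, c⟩ := hd
  exact ⟨g, a, b, c.trans h⟩

/-- A polynomial of `P` all of whose monomials are standard vanishes. -/
theorem aux_std_zero (m : MonomialOrder (Fin r)) (P : Ideal (MvPolynomial (Fin r) k))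
    (f : MvPolynomial (Fin r) k) (hf : f ∈ P)
    (h : ∀ d ∈ f.support, monomial d (1 : k) ∉ m.initialIdeal P) : f = 0 := by
  by_contra h0
  refine h _ (m.degree_mem_support h0) ?_
  rw [aux_mon_mem]
  exact ⟨f, hf, h0, le_rfl⟩

/-- Normal forms. -/
theorem aux_nf (m : MonomialOrder (Fin r)) (P : Ideal (MvPolynomial (Fin r) k))
    (f : MvPolynomial (Fin r) k) : ∃ g, f - g ∈ P ∧
      ∀ d ∈ g.support, monomial d (1 : k) ∉ m.initialIdeal P := by
  obtain ⟨c, g, h1, -, h2⟩ := m.div_set (B := {f | f ∈ P ∧ f ≠ 0})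
    (fun b hb => by
      rw [isUnit_iff_ne_zero]
      exact m.leadingCoeff_ne_zero_iff.2 hb.2) f
  refine ⟨g, ?_, ?_⟩
  · rw [h1, add_sub_cancel_right, Finsupp.linearCombination_apply]
    exact Ideal.sum_mem _ fun b _ => P.mul_mem_left _ b.2.1
  · intro d hd hm
    rw [aux_mon_mem] at hm
    obtain ⟨q, a, b, e⟩ := hm
    exact h2 d hd q ⟨a, b⟩ e

/-- Homogeneous normal forms. -/
theorem aux_nf_hom (m : MonomialOrder (Fin r)) (P : Ideal (MvPolynomial (Fin r) k))
    (hhom : P.IsHomogeneous (homogeneousSubmodule (Fin r) k))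
    (f : MvPolynomial (Fin r) k) (j : ℕ) (hf : f.IsHomogeneous j) : ∃ g, f - g ∈ P ∧
      ∀ d ∈ g.support, d.degree = j ∧ monomial d (1 : k) ∉ m.initialIdeal P := by
  obtain ⟨g, h1, h2⟩ := aux_nf m P f
  refine ⟨homogeneousComponent j g, ?_, ?_⟩
  · have := homogeneousComponent_mem_of_mem hhom h1 j
    rwa [map_sub, homogeneousComponent_eq_self hf] at this
  · intro d hd
    rw [mem_support_iff, coeff_homogeneousComponent] at hd
    split_ifs at hd with hj
    · exact ⟨hj, h2 d (mem_support_iff.2 hd)⟩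
    · exact absurd rfl hd

/-- Degree bound on generators of the initial ideal. -/
theorem aux_bound (m : MonomialOrder (Fin r)) (P : Ideal (MvPolynomial (Fin r) k)) :
    ∃ D : ℕ, ∀ d, monomial d (1 : k) ∈ m.initialIdeal P →
      ∃ e, e ≤ d ∧ e.degree ≤ D ∧ monomial e (1 : k) ∈ m.initialIdeal P := by
  classical
  have hfg : (m.initialIdeal P).FG := IsNoetherian.noetherian _
  unfold MonomialOrder.initialIdeal at hfg
  obtain ⟨s, hs, hss⟩ := (Submodule.fg_span_iff_fg_span_finset_subset _).1 hfg
  have hs' : (s : Set (MvPolynomial (Fin r) k)) ⊆ (fun d => monomial d (1 : k)) ''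
      (m.leadExp '' {f | f ∈ P ∧ f ≠ 0}) := by
    rw [Set.image_image]; exact hs
  obtain ⟨t, ht, rfl⟩ := Finset.subset_set_image_iff.1 hs'
  have hI : m.initialIdeal P = Ideal.span ((fun d => monomial d (1 : k)) '' (t : Set _)) := by
    rw [← Finset.coe_image]
    exact hss
  refine ⟨t.sup fun d => d.degree, fun d hd => ?_⟩
  rw [hI, mem_ideal_span_monomial_image] at hd
  obtain ⟨e, he, hed⟩ := hd d (by simp [support_monomial])
  refine ⟨e, hed, Finset.le_sup (f := fun d : Fin r →₀ ℕ => d.degree) he, ?_⟩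
  rw [hI]
  exact Ideal.subset_span ⟨e, he, rfl⟩

/-- Borel moves iterated. -/
theorem aux_borel (I : Ideal (MvPolynomial (Fin r) k))
    (hborel : ∀ (J : Fin r →₀ ℕ) (a : Fin r) (ha : a.val + 1 < r),
      monomial J (1 : k) ∈ I → 0 < J ⟨a.val + 1, ha⟩ →
      monomial (J + Finsupp.single a 1 - Finsupp.single ⟨a.val + 1, ha⟩ 1) (1 : k) ∈ I)
    (d : Fin r →₀ ℕ) (n : ℕ) : ∀ (i j : Fin r), j.val = i.val + n →
      monomial (d + Finsupp.single j 1) (1 : k) ∈ I →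
      monomial (d + Finsupp.single i 1) (1 : k) ∈ I := by
  induction n with
  | zero =>
    intro i j h hj
    obtain rfl : j = i := Fin.ext h
    exact hj
  | succ n ih =>
    intro i j h hj
    have hj' := j.2
    have h1 : i.val + n + 1 < r := by omega
    obtain rfl : j = ⟨i.val + n + 1, h1⟩ := Fin.ext h
    refine ih i ⟨i.val + n, by omega⟩ rfl ?_
    have := hborel _ ⟨i.val + n, by omega⟩ h1 hj (by simp)
    convert this using 2
    rw [add_right_comm, add_tsub_cancel_right]

theorem aux_prime (S : Set (Fin r)) :
    (Ideal.span ((fun i => (X i : MvPolynomial (Fin r) k)) '' S)).IsPrime := by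
  classical
  set Q := Ideal.span ((fun i => (X i : MvPolynomial (Fin r) k)) '' S) with hQ
  let φ : MvPolynomial (Fin r) k →ₐ[k] MvPolynomial (Fin r) k :=
    aeval fun i => if i ∈ S then 0 else X i
  have h1 : (Ideal.Quotient.mkₐ k Q).comp φ = Ideal.Quotient.mkₐ k Q := by
    ext i
    simp only [φ, AlgHom.comp_apply, aeval_X]
    split_ifs with hi
    · rw [map_zero]
      have hm : (X i : MvPolynomial (Fin r) k) ∈ Q := Ideal.subset_span ⟨i, hi, rfl⟩
      exact (Ideal.Quotient.eq_zero_iff_mem.2 hm).symm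
    · rfl
  have h2 : Q = RingHom.ker φ := by
    apply le_antisymm
    · rw [hQ, Ideal.span_le]
      rintro _ ⟨i, hi, rfl⟩
      simp [φ, RingHom.mem_ker, hi]
    · intro f hf
      have := DFunLike.congr_fun h1 f
      rw [AlgHom.comp_apply, (RingHom.mem_ker).1 hf, map_zero] at this
      exact Ideal.Quotient.eq_zero_iff_mem.1 this.symm
  rw [h2]
  exact RingHom.ker_isPrime _

end Helpers

/-- if `P` is a homogeneous prime with `dim(R/P) = 2`, `I = in(P)` is Borel-fixed,
and the maximal ideal `(x_1,...,x_r)` is an associated prime of `R/I`, then `(x_1,...,x_{r-1})`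
is also an associated prime of `R/I`. -/
theorem penultimate_prime_is_associated {k : Type*} [Field k] {r : ℕ}
    (P : Ideal (MvPolynomial (Fin r) k)) (hP : P.IsPrime)
    (hhom : P.IsHomogeneous (homogeneousSubmodule (Fin r) k))
    (hdim : ringKrullDim (MvPolynomial (Fin r) k ⧸ P) = 2)
    (m : MonomialOrder (Fin r)) (I : Ideal (MvPolynomial (Fin r) k))
    (hI : I = m.initialIdeal P)
    (hborel : ∀ (J : Fin r →₀ ℕ) (a : Fin r) (ha : a.val + 1 < r),
      monomial J (1 : k) ∈ I → 0 < J ⟨a.val + 1, ha⟩ →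
      monomial (J + Finsupp.single a 1 - Finsupp.single ⟨a.val + 1, ha⟩ 1) (1 : k) ∈ I)
    (hmax : IsAssociatedPrime (Ideal.span (Set.range (X : Fin r → MvPolynomial (Fin r) k)))
      (MvPolynomial (Fin r) k ⧸ I)) :
    IsAssociatedPrime
      (Ideal.span ((fun i => (X i : MvPolynomial (Fin r) k)) '' {i : Fin r | i.val < r - 1}))
      (MvPolynomial (Fin r) k ⧸ I) := by
  have hr : 2 ≤ r := by
    have h1 := ringKrullDim_quotient_le P
    rw [hdim, MvPolynomial.ringKrullDim_of_isNoetherianRing, ringKrullDim_eq_zero_of_field,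
      zero_add, Nat.card_eq_fintype_card, Fintype.card_fin] at h1
    exact_mod_cast h1
  have hB : ∀ (d : Fin r →₀ ℕ) (i j : Fin r), i ≤ j →
      monomial (d + Finsupp.single j 1) (1 : k) ∈ I →
      monomial (d + Finsupp.single i 1) (1 : k) ∈ I := fun d i j hij =>
    aux_borel I hborel d (j.val - i.val) i j (by have : i.val ≤ j.val := hij; omega)
  subst hI
  obtain ⟨l, hl⟩ : ∃ l : Fin r, l.val = r - 1 := ⟨⟨r - 1, by omega⟩, rfl⟩
  obtain ⟨p, hp⟩ : ∃ p : Fin r, p.val = r - 2 := ⟨⟨r - 2, by omega⟩, rfl⟩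
  have hpl : p ≠ l := fun h => by subst h; omega
  have hle : ∀ i : Fin r, i ≤ l := fun i => by
    have := i.2; exact Fin.le_def.2 (by omega)
  have hX : (X l : MvPolynomial (Fin r) k) ∉ P := by
    intro hXP
    have h1 : monomial (0 + Finsupp.single l 1) (1 : k) ∈ m.initialIdeal P := by
      rw [zero_add, aux_mon_mem]
      exact ⟨X l, hXP, X_ne_zero l, by rw [m.degree_X]⟩
    have h2 : ∀ i, monomial (Finsupp.single i 1) (1 : k) ∈ m.initialIdeal P := fun i => by
      simpa using hB 0 i l (hle i) h1
    have hs : Function.Surjective ((Ideal.Quotient.mk P).comp (C : k →+* MvPolynomial (Fin r) k)) := by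
      intro q
      obtain ⟨f, rfl⟩ := Ideal.Quotient.mk_surjective q
      obtain ⟨g, hg1, hg2⟩ := aux_nf m P f
      have h0 : g = C (coeff 0 g) := by
        ext d
        rw [coeff_C]
        split_ifs with hd
        · rw [hd]
        · by_contra hne
          obtain ⟨i, hi⟩ := Finsupp.ne_iff.1 (Ne.symm hd)
          refine hg2 d (mem_support_iff.2 hne) (aux_mon_mono m P ?_ (h2 i))
          rw [Finsupp.single_le_iff]
          exact Nat.one_le_iff_ne_zero.2 hi
      refine ⟨coeff 0 g, ?_⟩
      rw [RingHom.comp_apply, ← h0]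
      exact (Ideal.Quotient.eq.2 hg1).symm
    have h3 := ringKrullDim_le_of_surjective _ hs
    rw [hdim, ringKrullDim_eq_zero_of_field] at h3
    exact absurd h3 (by decide)
  obtain ⟨D, hD⟩ := aux_bound m P
  have hDl : ∀ d : Fin r →₀ ℕ, D ≤ d.degree →
      monomial (d + Finsupp.single l 1) (1 : k) ∈ m.initialIdeal P →
      monomial d (1 : k) ∈ m.initialIdeal P := by
    intro d hd hm
    obtain ⟨e, he, heD, hem⟩ := hD _ hm
    by_cases hed : e ≤ d
    · exact aux_mon_mono m P hed hem
    have hel : Finsupp.single l 1 ≤ e := by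
      rw [Finsupp.single_le_iff]
      by_contra h0
      refine hed fun i => ?_
      have := he i
      by_cases hi : i = l
      · subst hi; omega
      · simpa [Finsupp.single_apply, Ne.symm hi] using this
    obtain ⟨e', rfl⟩ := exists_add_of_le hel
    rw [add_comm] at he hem
    have he' : e' ≤ d := le_of_add_le_add_right he
    obtain ⟨c, rfl⟩ := exists_add_of_le he'
    have hc : c ≠ 0 := by
      rintro rfl
      simp at heD hd
      omega
    obtain ⟨i, hi⟩ := Finsupp.ne_iff.1 hc
    have hic : Finsupp.single i 1 ≤ c := by
      rw [Finsupp.single_le_iff]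
      exact Nat.one_le_iff_ne_zero.2 hi
    exact aux_mon_mono m P (add_le_add_right hic e') (hB e' i l (hle i) hem)
  have hDl' : ∀ (N : ℕ) (d : Fin r →₀ ℕ), D ≤ d.degree →
      monomial (d + Finsupp.single l N) (1 : k) ∈ m.initialIdeal P →
      monomial d (1 : k) ∈ m.initialIdeal P := by
    intro N
    induction N with
    | zero => intro d _ h; simpa using h
    | succ N ih =>
      intro d hd h
      refine ih d hd (hDl _ ?_ ?_)
      · simp; omega
      · rwa [add_assoc, ← Finsupp.single_add]
  by_contra hna
  have hDp : ∀ d : Fin r →₀ ℕ, D ≤ d.degree →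
      monomial (d + Finsupp.single p 1) (1 : k) ∈ m.initialIdeal P →
      monomial d (1 : k) ∈ m.initialIdeal P := by
    intro d hd hm
    by_contra hdI
    apply hna
    rw [isAssociatedPrime_iff]
    refine ⟨aux_prime _, Ideal.Quotient.mk _ (monomial d 1), ?_⟩
    ext f
    rw [Submodule.mem_colon_singleton, Submodule.mem_bot, ← Ideal.Quotient.mk_eq_mk,
      ← Submodule.Quotient.mk_smul, Submodule.Quotient.mk_eq_zero, mem_ideal_span_X_image,
      smul_eq_mul, aux_mem_iff_mon]
    constructor
    · intro h e he
      rw [mem_support_iff, coeff_mul_monomial'] at he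
      split_ifs at he with h'
      · obtain ⟨e', rfl⟩ := exists_add_of_le h'
        rw [add_tsub_cancel_left, mul_one] at he
        obtain ⟨i, hi, hi'⟩ := h e' (mem_support_iff.2 he)
        have hip : i ≤ p := Fin.le_def.2 (by have : i.val < r - 1 := hi; omega)
        refine aux_mon_mono m P (add_le_add_right ?_ d) (hB d i p hip hm)
        rw [Finsupp.single_le_iff]
        exact Nat.one_le_iff_ne_zero.2 hi'
      · exact absurd rfl he
    · intro h e he
      by_contra hcon
      push Not at hcon
      have hel : e = Finsupp.single l (e l) := by
        ext i
        by_cases hi : i = l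
        · subst hi; simp
        · rw [Finsupp.single_eq_of_ne hi]
          refine hcon i ?_
          have h1 := i.2
          have h2 : i.val ≠ l.val := fun h => hi (Fin.ext h)
          show i.val < r - 1
          omega
      refine hdI (hDl' (e l) d hd ?_)
      rw [← hel]
      apply h
      rw [mem_support_iff, add_comm, coeff_mul_monomial, mul_one]
      exact mem_support_iff.1 he
  have hDp' : ∀ (N : ℕ) (d : Fin r →₀ ℕ), D ≤ d.degree →
      monomial (d + Finsupp.single p N) (1 : k) ∈ m.initialIdeal P →
      monomial d (1 : k) ∈ m.initialIdeal P := by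
    intro N
    induction N with
    | zero => intro d _ h; simpa using h
    | succ N ih =>
      intro d hd h
      refine ih d hd (hDp _ ?_ ?_)
      · simp; omega
      · rwa [add_assoc, ← Finsupp.single_add]
  obtain ⟨u, hu, hul⟩ : ∃ u : Fin r →₀ ℕ, monomial u (1 : k) ∉ m.initialIdeal P ∧
      monomial (u + Finsupp.single l 1) (1 : k) ∈ m.initialIdeal P := by
    rw [isAssociatedPrime_iff] at hmax
    obtain ⟨hpr, x, hx⟩ := hmax
    obtain ⟨f, rfl⟩ := Ideal.Quotient.mk_surjective x
    have hf : f ∉ m.initialIdeal P := by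
      intro hf
      apply hpr.ne_top
      rw [hx, Ideal.eq_top_iff_one, Submodule.mem_colon_singleton, one_smul, Submodule.mem_bot]
      exact Ideal.Quotient.eq_zero_iff_mem.2 hf
    have hlf : X l * f ∈ m.initialIdeal P := by
      have h1 : (X l : MvPolynomial (Fin r) k) ∈ Ideal.span (Set.range (X : Fin r → MvPolynomial (Fin r) k)) :=
        Ideal.subset_span ⟨l, rfl⟩
      rw [hx, Submodule.mem_colon_singleton, Submodule.mem_bot] at h1
      exact Ideal.Quotient.eq_zero_iff_mem.1 h1
    rw [aux_mem_iff_mon] at hf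
    push Not at hf
    obtain ⟨u, hu, hu'⟩ := hf
    refine ⟨u, hu', (aux_mem_iff_mon m P _).1 hlf _ ?_⟩
    rw [mem_support_iff, add_comm, coeff_X_mul]
    exact mem_support_iff.1 hu
  -- main argument
  have hhomog : ∀ i : Fin r, (monomial (u + Finsupp.single i (D + 1)) (1 : k)).IsHomogeneous
      (u.degree + (D + 1)) := fun i => isHomogeneous_monomial _ (by simp)
  obtain ⟨a, ha1, ha2⟩ := aux_nf_hom m P hhom _ _ (hhomog l)
  obtain ⟨b, hb1, hb2⟩ := aux_nf_hom m P hhom _ _ (hhomog p)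
  have hab : X p ^ (D + 1) * a - X l ^ (D + 1) * b = 0 := by
    classical
    apply aux_std_zero m P
    · have h1 := P.mul_mem_left (X p ^ (D + 1)) ha1
      have h2 := P.mul_mem_left (X l ^ (D + 1)) hb1
      have h3 := P.sub_mem h2 h1
      convert h3 using 1
      have : (X p : MvPolynomial (Fin r) k) ^ (D + 1) * monomial (u + Finsupp.single l (D + 1)) (1 : k)
          = X l ^ (D + 1) * monomial (u + Finsupp.single p (D + 1)) (1 : k) := by
        rw [X_pow_eq_monomial, X_pow_eq_monomial, monomial_mul, monomial_mul]
        rw [add_left_comm, add_left_comm (Finsupp.single l (D + 1)), add_comm (Finsupp.single p (D + 1))]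
      linear_combination this
    · intro d hd hdI
      rcases Finset.mem_union.1 (support_sub _ _ _ hd) with h | h
      · rw [X_pow_eq_monomial, mem_support_iff, coeff_monomial_mul'] at h
        split_ifs at h with h'
        · obtain ⟨e, rfl⟩ := exists_add_of_le h'
          rw [add_tsub_cancel_left, one_mul] at h
          have := ha2 e (mem_support_iff.2 h)
          exact this.2 (hDp' _ _ (by omega) (by rwa [add_comm] at hdI))
        · exact h rfl
      · rw [X_pow_eq_monomial, mem_support_iff, coeff_monomial_mul'] at h
        split_ifs at h with h'
        · obtain ⟨e, rfl⟩ := exists_add_of_le h'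
          rw [add_tsub_cancel_left, one_mul] at h
          have := hb2 e (mem_support_iff.2 h)
          exact this.2 (hDl' _ _ (by omega) (by rwa [add_comm] at hdI))
        · exact h rfl
  have hdvd : (X l : MvPolynomial (Fin r) k) ^ (D + 1) ∣ a := by
    refine (X_prime (R := k) (i := l)).pow_dvd_of_dvd_mul_left (a := X p ^ (D + 1)) _ ?_ ⟨b, sub_eq_zero.1 hab⟩
    intro h
    have := (X_prime (R := k) (i := l)).dvd_of_dvd_pow h
    rw [X_dvd_X] at this
    simp_all
  obtain ⟨c, rfl⟩ := hdvd
  have hc : ∀ d ∈ c.support, monomial (d + Finsupp.single l (D + 1)) (1 : k) ∉ m.initialIdeal P := by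
    intro d hd
    refine (ha2 _ ?_).2
    rw [X_pow_eq_monomial, mem_support_iff, add_comm, coeff_monomial_mul, one_mul]
    exact mem_support_iff.1 hd
  have huc : monomial u (1 : k) - c ∈ P := by
    have h1 : X l ^ (D + 1) * (monomial u (1 : k) - c) ∈ P := by
      convert ha1 using 1
      rw [mul_sub, X_pow_eq_monomial, monomial_mul, add_comm, one_mul]
    exact (hP.mem_or_mem h1).resolve_left fun h => hX (hP.mem_of_pow_mem _ h)
  have hcu : coeff u c = 0 := by
    by_contra h
    refine hc u (mem_support_iff.2 h) (aux_mon_mono m P ?_ hul)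
    exact add_le_add_right (Finsupp.single_mono (by omega)) u
  have h0 : monomial u (1 : k) - c = 0 := by
    classical
    refine aux_std_zero m P _ huc fun d hd => ?_
    rcases Finset.mem_union.1 (support_sub _ _ _ hd) with h | h
    · have : d = u := by simpa [support_monomial] using h
      rwa [this]
    · exact fun hdI => hc d h (aux_mon_mono m P le_self_add hdI)
  have := congrArg (coeff u) h0
  simp [hcu] at this
end
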